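/- arXiv:1608.01008 — 2 statements merged into one kernel-verified Lean document; each statement's English description precedes it below -/
import Mathlib

section
/- Let π be a strongly Rayleigh probability distribution on the subsets of [N] and let π_sh be its symmetric homogenization on subsets of [2N]. Consider the lazy Metropolis exchange chain for π_sh on Ω = {T ⊆ [2N] : |T| = N}. Then for every starting state Y0 ∈ Ω with π(Y0 ∩ [N]) > 0 and every ε ∈ (0,1), writing X0 = Y0 ∩ [N], the mixing time satisfies τ_{Y0}(ε) ≤ 2N² · (log binom(N,|X0|) + log π(X0)^{-1} + log ε^{-1}). -/
open Finset
open scoped Classical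

/-- Total variation distance between the `t`-step distribution of the chain with
transition matrix `P` started at `x0` and the distribution `μ`. -/
noncomputable def tvDist {Ω : Type*} [Fintype Ω] [DecidableEq Ω]
    (P : Matrix Ω Ω ℝ) (μ : Ω → ℝ) (x0 : Ω) (t : ℕ) : ℝ :=
  (1 / 2) * ∑ y, |(P ^ t) x0 y - μ y|

/-- Mixing time `τ_{x0}(ε)`. -/
noncomputable def mixingTime {Ω : Type*} [Fintype Ω] [DecidableEq Ω]
    (P : Matrix Ω Ω ℝ) (μ : Ω → ℝ) (x0 : Ω) (ε : ℝ) : ℕ :=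
  sInf {t : ℕ | ∀ t' ≥ t, tvDist P μ x0 t' ≤ ε}

/-- The intersection `T ∩ [N]` of a subset `T ⊆ [2N]` with `[N]`, viewed as a subset
of `[N]`. -/
def restrictDown (N : ℕ) (T : Finset (Fin (2 * N))) : Finset (Fin N) :=
  Finset.univ.filter fun i : Fin N => Fin.castLE (by omega) i ∈ T

/-- The symmetric homogenization `π_sh` of a distribution `π` on subsets of `[N]`:
`π_sh(T) = π(T∩[N]) · binom(N, |T∩[N]|)⁻¹` if `|T| = N`, and `0` otherwise. -/
noncomputable def symmHom (N : ℕ) (π : Finset (Fin N) → ℝ)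
    (T : Finset (Fin (2 * N))) : ℝ :=
  if T.card = N then π (restrictDown N T) / (N.choose (restrictDown N T).card : ℝ) else 0

/-- The generating polynomial of `π`, as a function of complex arguments. -/
noncomputable def genPoly {M : ℕ} (π : Finset (Fin M) → ℝ) (z : Fin M → ℂ) : ℂ :=
  ∑ S : Finset (Fin M), (π S : ℂ) * ∏ i ∈ S, z i

/-- A distribution on subsets of `[M]` is strongly Rayleigh if its generating polynomial
is real stable. -/
def StronglyRayleigh {M : ℕ} (π : Finset (Fin M) → ℝ) : Prop :=
  ∀ z : Fin M → ℂ, (∀ i, 0 < (z i).im) → genPoly π z ≠ 0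

/-- The state space of the lazy Metropolis exchange chain for `π_sh`: the subsets of
`[2N]` of cardinality `N` lying in the support of `π_sh`. -/
abbrev HomState (N : ℕ) (π : Finset (Fin N) → ℝ) : Type :=
  {T : Finset (Fin (2 * N)) // T.card = N ∧ 0 < symmHom N π T}

set_option linter.unusedSectionVars false
set_option linter.unusedFintypeInType false
set_option linter.unusedDecidableInType false

/-! ### Weights on finite sets, conditioning and the Rayleigh property -/
section Weights

variable {ι : Type*} [Fintype ι] [DecidableEq ι]

/-- Restriction of a weight to the sets containing `e`. -/
def wInc (μ : Finset ι → ℝ) (e : ι) : Finset ι → ℝ := fun S => if e ∈ S then μ S else 0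

/-- Restriction of a weight to the sets not containing `e`. -/
def wExc (μ : Finset ι → ℝ) (e : ι) : Finset ι → ℝ := fun S => if e ∈ S then 0 else μ S

/-- Partition function. -/
def wZ (μ : Finset ι → ℝ) (x : ι → ℝ) : ℝ := ∑ S, μ S * ∏ i ∈ S, x i

/-- The Rayleigh property (pairwise negative correlation under every positive field). -/
def Ray (μ : Finset ι → ℝ) : Prop :=
  ∀ x : ι → ℝ, (∀ i, 0 < x i) → ∀ i j, i ≠ j →
    wZ μ x * wZ (wInc (wInc μ i) j) x ≤ wZ (wInc μ i) x * wZ (wInc μ j) x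

lemma wInc_comm (μ : Finset ι → ℝ) (e f : ι) : wInc (wInc μ e) f = wInc (wInc μ f) e := by
  funext S; simp only [wInc]; split_ifs <;> rfl

lemma wInc_wExc_comm (μ : Finset ι → ℝ) (e f : ι) :
    wInc (wExc μ e) f = wExc (wInc μ f) e := by
  funext S; simp only [wInc, wExc]; split_ifs <;> rfl

lemma wExc_comm (μ : Finset ι → ℝ) (e f : ι) : wExc (wExc μ e) f = wExc (wExc μ f) e := by
  funext S; simp only [wExc]; split_ifs <;> rfl

lemma wInc_idem (μ : Finset ι → ℝ) (e : ι) : wInc (wInc μ e) e = wInc μ e := by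
  funext S; simp only [wInc]; split_ifs <;> rfl

lemma wExc_wInc_self (μ : Finset ι → ℝ) (e : ι) : wInc (wExc μ e) e = 0 := by
  funext S; simp only [wInc, wExc]; split_ifs <;> rfl

lemma wExc_add_wInc (μ : Finset ι → ℝ) (e : ι) (S : Finset ι) :
    wExc μ e S + wInc μ e S = μ S := by
  simp only [wInc, wExc]; split_ifs <;> simp

lemma wZ_zero (x : ι → ℝ) : wZ (0 : Finset ι → ℝ) x = 0 := by simp [wZ]

lemma wZ_scale (μ : Finset ι → ℝ) (x : ι → ℝ) (e : ι) (t : ℝ) :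
    wZ μ (Function.update x e (t * x e)) = wZ (wExc μ e) x + t * wZ (wInc μ e) x := by
  simp only [wZ, Finset.mul_sum, ← Finset.sum_add_distrib]
  refine Finset.sum_congr rfl fun S _ => ?_
  by_cases h : e ∈ S
  · rw [Finset.prod_update_of_mem h, ← Finset.mul_prod_erase S x h]
    simp only [wExc, wInc, h, if_true, Finset.sdiff_singleton_eq_erase]
    ring
  · rw [Finset.prod_update_of_notMem h]
    simp [wExc, wInc, h]

lemma quad_lim (A0 A1 B0 B1 C0 C1 D0 D1 : ℝ)
    (h : ∀ t : ℝ, 0 < t → (A0 + t * A1) * (D0 + t * D1) ≤ (B0 + t * B1) * (C0 + t * C1)) :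
    A0 * D0 ≤ B0 * C0 ∧ A1 * D1 ≤ B1 * C1 := by
  set a := B0 * C0 - A0 * D0 with ha
  set b := B0 * C1 + B1 * C0 - A0 * D1 - A1 * D0 with hb
  set c := B1 * C1 - A1 * D1 with hc
  have h1 : ∀ t : ℝ, 0 < t → 0 ≤ a + b * t + c * t ^ 2 := by
    intro t ht
    have := h t ht
    rw [ha, hb, hc]; nlinarith
  have hA : 0 ≤ a := by
    by_contra hneg
    push Not at hneg
    have hp : 0 < |b| + |c| + 1 := by positivity
    obtain ⟨t, ht0, ht1, ht2⟩ : ∃ t : ℝ, 0 < t ∧ t ≤ 1 ∧ t * (|b| + |c| + 1) ≤ -a := by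
      refine ⟨min 1 (-a / (|b| + |c| + 1)), by
        apply lt_min one_pos; apply div_pos <;> linarith, min_le_left _ _, ?_⟩
      rw [← le_div_iff₀ hp]; exact min_le_right _ _
    have := h1 t ht0
    have e1 : b * t ≤ |b| * t := by gcongr; exact le_abs_self b
    have e2 : c * t ^ 2 ≤ |c| * t := by
      calc c * t ^ 2 ≤ |c| * t ^ 2 := by gcongr; exact le_abs_self c
        _ ≤ |c| * t := by gcongr; nlinarith
    nlinarith
  have hC : 0 ≤ c := by
    by_contra hneg
    push Not at hneg
    have hp : 0 < |b| + |a| + 1 := by positivity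
    obtain ⟨t, ht0, ht2⟩ : ∃ t : ℝ, 1 ≤ t ∧ (|b| + |a| + 1) ≤ -c * t := by
      refine ⟨max 1 ((|b| + |a| + 1) / -c), le_max_left _ _, ?_⟩
      rw [mul_comm, ← div_le_iff₀ (by linarith)]; exact le_max_right _ _
    have := h1 t (by linarith)
    have e1 : b * t ≤ |b| * t := by gcongr; exact le_abs_self b
    have e2 : a ≤ |a| * t := (le_abs_self a).trans (by nlinarith [abs_nonneg a])
    nlinarith
  constructor <;> linarith

lemma Ray.incexc {μ : Finset ι → ℝ} (h : Ray μ) (e : ι) :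
    Ray (wExc μ e) ∧ Ray (wInc μ e) := by
  have key : ∀ x : ι → ℝ, (∀ i, 0 < x i) → ∀ i j, i ≠ j →
    wZ (wExc μ e) x * wZ (wInc (wInc (wExc μ e) i) j) x
      ≤ wZ (wInc (wExc μ e) i) x * wZ (wInc (wExc μ e) j) x ∧
    wZ (wInc μ e) x * wZ (wInc (wInc (wInc μ e) i) j) x
      ≤ wZ (wInc (wInc μ e) i) x * wZ (wInc (wInc μ e) j) x := by
    intro x hx i j hij
    have := quad_lim (wZ (wExc μ e) x) (wZ (wInc μ e) x)
      (wZ (wExc (wInc μ i) e) x) (wZ (wInc (wInc μ i) e) x)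
      (wZ (wExc (wInc μ j) e) x) (wZ (wInc (wInc μ j) e) x)
      (wZ (wExc (wInc (wInc μ i) j) e) x) (wZ (wInc (wInc (wInc μ i) j) e) x) (by
        intro t ht
        simp only [← wZ_scale]
        apply h _ _ i j hij
        intro k
        by_cases hk : k = e
        · subst hk; simpa using mul_pos ht (hx k)
        · simpa [hk] using hx k)
    rw [wInc_wExc_comm, wInc_wExc_comm, wInc_wExc_comm, wInc_comm μ e i, wInc_comm μ e j,
      wInc_comm (wInc μ i) e j]
    exact this
  exact ⟨fun x hx i j hij => (key x hx i j hij).1, fun x hx i j hij => (key x hx i j hij).2⟩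

end Weights

set_option linter.unusedSectionVars false

section Dual
variable {ι : Type*} [Fintype ι] [DecidableEq ι]

/-- Integral of `h` against the weight `μ`. -/
def wI (μ : Finset ι → ℝ) (h : Finset ι → ℝ) : ℝ := ∑ S, μ S * h S

/-- Total mass. -/
def wM (μ : Finset ι → ℝ) : ℝ := ∑ S, μ S

/-- support -/
noncomputable def wSupp (μ : Finset ι → ℝ) : Finset (Finset ι) := Finset.univ.filter fun S => μ S ≠ 0

lemma wInc_nonneg {μ : Finset ι → ℝ} (h : ∀ S, 0 ≤ μ S) (e : ι) : ∀ S, 0 ≤ wInc μ e S := by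
  intro S; unfold wInc; split_ifs; exacts [h S, le_rfl]

lemma wExc_nonneg {μ : Finset ι → ℝ} (h : ∀ S, 0 ≤ μ S) (e : ι) : ∀ S, 0 ≤ wExc μ e S := by
  intro S; unfold wExc; split_ifs; exacts [le_rfl, h S]

lemma wInc_ne {μ : Finset ι → ℝ} {e : ι} {S : Finset ι} (h : wInc μ e S ≠ 0) : e ∈ S ∧ μ S ≠ 0 := by
  unfold wInc at h; split_ifs at h with h1
  · exact ⟨h1, h⟩
  · exact absurd rfl h

lemma wExc_ne {μ : Finset ι → ℝ} {e : ι} {S : Finset ι} (h : wExc μ e S ≠ 0) : e ∉ S ∧ μ S ≠ 0 := by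
  unfold wExc at h; split_ifs at h with h1
  · exact absurd rfl h
  · exact ⟨h1, h⟩

lemma wM_nonneg {μ : Finset ι → ℝ} (h : ∀ S, 0 ≤ μ S) : 0 ≤ wM μ := Finset.sum_nonneg fun S _ => h S

lemma wM_pos {μ : Finset ι → ℝ} (h : ∀ S, 0 ≤ μ S) {S : Finset ι} (hS : μ S ≠ 0) : 0 < wM μ :=
  Finset.sum_pos' (fun S _ => h S) ⟨S, Finset.mem_univ _, lt_of_le_of_ne (h S) hS.symm⟩

lemma wM_eq_zero {μ : Finset ι → ℝ} (h : ∀ S, 0 ≤ μ S) (h0 : wM μ = 0) : μ = 0 := by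
  funext S
  by_contra hS
  exact (wM_pos h hS).ne' h0

lemma wM_exists {μ : Finset ι → ℝ} (h0 : wM μ ≠ 0) : ∃ S, μ S ≠ 0 := by
  by_contra hc
  push Not at hc
  exact h0 (Finset.sum_eq_zero fun S _ => hc S)

lemma wI_split (μ : Finset ι → ℝ) (h : Finset ι → ℝ) (e : ι) :
    wI μ h = wI (wInc μ e) h + wI (wExc μ e) h := by
  simp only [wI, ← Finset.sum_add_distrib]
  refine Finset.sum_congr rfl fun S _ => ?_
  rw [← wExc_add_wInc μ e S]; ring

lemma wM_split (μ : Finset ι → ℝ) (e : ι) :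
    wM μ = wM (wInc μ e) + wM (wExc μ e) := by
  simp only [wM, ← Finset.sum_add_distrib]
  refine Finset.sum_congr rfl fun S _ => ?_
  rw [← wExc_add_wInc μ e S]; ring

lemma wSupp_inc_lt {μ : Finset ι → ℝ} {e : ι} (h : ∃ S, wExc μ e S ≠ 0) :
    (wSupp (wInc μ e)).card < (wSupp μ).card := by
  obtain ⟨S, hS⟩ := h
  apply Finset.card_lt_card
  rw [Finset.ssubset_iff_of_subset]
  · refine ⟨S, by simpa [wSupp] using (wExc_ne hS).2, ?_⟩
    simp [wSupp, wInc, (wExc_ne hS).1]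
  · intro T hT
    simp only [wSupp, Finset.mem_filter, Finset.mem_univ, true_and] at hT ⊢
    exact (wInc_ne hT).2

lemma wSupp_exc_lt {μ : Finset ι → ℝ} {e : ι} (h : ∃ S, wInc μ e S ≠ 0) :
    (wSupp (wExc μ e)).card < (wSupp μ).card := by
  obtain ⟨S, hS⟩ := h
  apply Finset.card_lt_card
  rw [Finset.ssubset_iff_of_subset]
  · refine ⟨S, by simpa [wSupp] using (wInc_ne hS).2, ?_⟩
    simp [wSupp, wExc, (wInc_ne hS).1]
  · intro T hT
    simp only [wSupp, Finset.mem_filter, Finset.mem_univ, true_and] at hT ⊢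
    exact (wExc_ne hT).2

lemma wI_sum_inc {μ : Finset ι → ℝ} {k : ℕ} (hk : ∀ S, μ S ≠ 0 → S.card = k)
    (h : Finset ι → ℝ) : ∑ f, wI (wInc μ f) h = k * wI μ h := by
  simp only [wI, Finset.mul_sum]
  rw [Finset.sum_comm]
  refine Finset.sum_congr rfl fun S _ => ?_
  by_cases hS : μ S = 0
  · simp [wInc, hS]
  · rw [← hk S hS]
    simp only [wInc, ite_mul, zero_mul]
    rw [Finset.sum_ite_mem]
    simp

lemma wM_eq_wI (μ : Finset ι → ℝ) : wM μ = wI μ (fun _ => 1) := by simp [wM, wI]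

lemma wM_eq_wZ (μ : Finset ι → ℝ) : wM μ = wZ μ (fun _ => 1) := by simp [wM, wZ]

lemma Ray.neg {μ : Finset ι → ℝ} (h : Ray μ) {i j : ι} (hij : i ≠ j) :
    wM (wInc (wInc μ i) j) * wM (wExc (wExc μ i) j) ≤
      wM (wInc (wExc μ i) j) * wM (wExc (wInc μ i) j) := by
  have := h (fun _ => 1) (fun _ => one_pos) i j hij
  simp only [← wM_eq_wZ] at this
  have e1 := wM_split μ i
  have e2 := wM_split (wInc μ i) j
  have e3 := wM_split (wExc μ i) j
  have e4 : wM (wInc μ j) = wM (wInc (wInc μ i) j) + wM (wInc (wExc μ i) j) := by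
    rw [wM_split (wInc μ j) i, wInc_comm μ j i, wInc_wExc_comm]
  rw [e1, e2, e3, e4] at this
  nlinarith

/-- Feder-Mihail, dual form of the stochastic covering property. -/
lemma dual_ineq (n : ℕ) : ∀ (μ : Finset ι → ℝ), (wSupp μ).card ≤ n → (∀ S, 0 ≤ μ S) →
    ∀ k : ℕ, (∀ S, μ S ≠ 0 → S.card = k) → Ray μ → ∀ (e : ι) (g h : Finset ι → ℝ),
    (∀ S T, μ S ≠ 0 → μ T ≠ 0 → e ∉ S → e ∈ T → T.erase e ⊆ S → h T ≤ g S) →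
    wI (wInc μ e) h * wM (wExc μ e) ≤ wI (wExc μ e) g * wM (wInc μ e) := by
  induction n with
  | zero =>
    intro μ hc hμ k hk hR e g h hgh
    have : ∀ S, μ S = 0 := by
      intro S
      have : wSupp μ = ∅ := by simpa using hc
      by_contra hS
      have h2 : S ∈ wSupp μ := by simpa [wSupp] using hS
      rw [this] at h2; simp at h2
    have : μ = 0 := funext this
    subst this
    simp [wI, wM, wInc, wExc]
  | succ n ih =>
    intro μ hc hμ k hk hR e g h hgh
    by_cases hM1 : wM (wInc μ e) = 0
    · rw [wM_eq_zero (wInc_nonneg hμ e) hM1]; simp [wI, wM]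
    by_cases hf : ∃ f, wM (wInc (wInc μ e) f) ≠ 0 ∧ wM (wExc (wInc μ e) f) ≠ 0
    · -- inductive case
      set ν := wInc μ e with hν
      have hν0 : ∀ S, 0 ≤ ν S := wInc_nonneg hμ e
      have hνk : ∀ S, ν S ≠ 0 → S.card = k := fun S hS => hk S (wInc_ne hS).2
      obtain ⟨f, hf1, hf2, hf3⟩ : ∃ f, wM (wInc ν f) ≠ 0 ∧ wM (wExc ν f) ≠ 0 ∧
          wI ν h * wM (wInc ν f) ≤ wI (wInc ν f) h * wM ν := by
        by_contra hcon
        push Not at hcon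
        have hsum : ∑ f, (wI (wInc ν f) h * wM ν - wI ν h * wM (wInc ν f)) = 0 := by
          rw [Finset.sum_sub_distrib, ← Finset.sum_mul, ← Finset.mul_sum, wI_sum_inc hνk]
          have : ∑ f, wM (wInc ν f) = k * wM ν := by
            simp only [wM_eq_wI]; exact wI_sum_inc hνk _
          rw [this]; ring
        have hle : ∀ f, wI (wInc ν f) h * wM ν - wI ν h * wM (wInc ν f) ≤ 0 := by
          intro f
          by_cases h1 : wM (wInc ν f) = 0
          · rw [wM_eq_zero (wInc_nonneg hν0 f) h1]; simp [wI, wM]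
          by_cases h2 : wM (wExc ν f) = 0
          · have e1 := wM_eq_zero (wExc_nonneg hν0 f) h2
            have e2 := wI_split ν h f
            have e3 := wM_split ν f
            rw [e1] at e2 e3
            have e4 : wI (0 : Finset ι → ℝ) h = 0 := by simp [wI]
            have e5 : wM (0 : Finset ι → ℝ) = 0 := by simp [wM]
            rw [e2, e3, e4, e5]; simp
          · have := hcon f h1 h2; linarith
        obtain ⟨f, h1, h2⟩ := hf
        have h3 := hcon f h1 h2
        have : ∑ f, (wI (wInc ν f) h * wM ν - wI ν h * wM (wInc ν f)) < 0 := by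
          apply Finset.sum_neg' (fun f _ => hle f) ⟨f, Finset.mem_univ _, by linarith⟩
        linarith
      have hfe : f ≠ e := by
        rintro rfl
        apply hf2
        have : wExc ν f = 0 := by
          rw [hν, ← wInc_wExc_comm, wExc_wInc_self]
        rw [this]; simp [wM]
      have hs1 : (wSupp (wInc μ f)).card ≤ n := by
        have : (wSupp (wInc μ f)).card < (wSupp μ).card := by
          apply wSupp_inc_lt
          obtain ⟨S, hS⟩ := wM_exists hf2
          rw [hν, ← wInc_wExc_comm] at hS
          exact ⟨S, (wInc_ne hS).2⟩
        omega
      have hs2 : (wSupp (wExc μ f)).card ≤ n := by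
        have : (wSupp (wExc μ f)).card < (wSupp μ).card := by
          apply wSupp_exc_lt
          obtain ⟨S, hS⟩ := wM_exists hf1
          rw [hν, wInc_comm] at hS
          exact ⟨S, (wInc_ne hS).2⟩
        omega
      have ih1 := ih (wInc μ f) hs1 (wInc_nonneg hμ f) k (fun S hS => hk S (wInc_ne hS).2)
        (hR.incexc f).2 e g h
        (fun S T hS hT => hgh S T (wInc_ne hS).2 (wInc_ne hT).2)
      have ih2 := ih (wExc μ f) hs2 (wExc_nonneg hμ f) k (fun S hS => hk S (wExc_ne hS).2)
        (hR.incexc f).1 e g h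
        (fun S T hS hT => hgh S T (wExc_ne hS).2 (wExc_ne hT).2)
      have hneg := hR.neg hfe.symm
      rw [wInc_comm μ f e, ← wInc_wExc_comm, ← hν] at ih1
      rw [wInc_wExc_comm μ f e, wExc_comm μ f e, ← hν] at ih2
      rw [← hν] at hneg
      rw [wI_split ν h f, wM_split ν f] at hf3
      rw [wI_split ν h f, wM_split ν f, wI_split (wExc μ e) g f, wM_split (wExc μ e) f]
      have p1 : 0 < wM (wInc ν f) :=
        lt_of_le_of_ne (wM_nonneg (wInc_nonneg hν0 f)) (Ne.symm hf1)
      have p2 : 0 < wM (wExc ν f) :=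
        lt_of_le_of_ne (wM_nonneg (wExc_nonneg hν0 f)) (Ne.symm hf2)
      generalize wM (wInc ν f) = M1f at *
      generalize wM (wExc ν f) = M1g at *
      obtain ⟨a, ha⟩ : ∃ a, wI (wInc ν f) h = a * M1f := ⟨_, (div_mul_cancel₀ _ p1.ne').symm⟩
      obtain ⟨b, hb⟩ : ∃ a, wI (wExc ν f) h = a * M1g := ⟨_, (div_mul_cancel₀ _ p2.ne').symm⟩
      rw [ha] at ih1 hf3 ⊢
      rw [hb] at ih2 hf3 ⊢
      generalize wM (wInc (wExc μ e) f) = M0f at *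
      generalize wM (wExc (wExc μ e) f) = M0g at *
      have ih1' : a * M0f ≤ wI (wInc (wExc μ e) f) g := by
        apply le_of_mul_le_mul_right _ p1; linarith
      have ih2' : b * M0g ≤ wI (wExc (wExc μ e) f) g := by
        apply le_of_mul_le_mul_right _ p2; linarith
      have hab : b ≤ a := by
        have : b * (M1f * M1g) ≤ a * (M1f * M1g) := by nlinarith
        exact le_of_mul_le_mul_right this (by positivity)
      have q1 : (a * M0f + b * M0g) * (M1f + M1g) ≤
        (wI (wInc (wExc μ e) f) g + wI (wExc (wExc μ e) f) g) * (M1f + M1g) := by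
        gcongr
      nlinarith [mul_nonneg (sub_nonneg.2 hab) (sub_nonneg.2 hneg)]
    · -- base case
      push Not at hf
      obtain ⟨T, hT⟩ := wM_exists hM1
      have hTe := (wInc_ne hT).1
      have hTμ := (wInc_ne hT).2
      have huniq : ∀ T', wInc μ e T' ≠ 0 → T' = T := by
        intro T' hT'
        ext f
        constructor
        · intro h1
          by_contra h2
          have a1 : wM (wInc (wInc μ e) f) ≠ 0 := by
            apply (wM_pos (wInc_nonneg (wInc_nonneg hμ e) f) (S := T') _).ne'
            rw [wInc, if_pos h1]; exact hT'
          have a2 := hf f a1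
          have a3 := wM_eq_zero (wExc_nonneg (wInc_nonneg hμ e) f) a2
          have a4 := congrFun a3 T
          rw [wExc, if_neg h2] at a4
          exact hT a4
        · intro h1
          by_contra h2
          have a1 : wM (wInc (wInc μ e) f) ≠ 0 := by
            apply (wM_pos (wInc_nonneg (wInc_nonneg hμ e) f) (S := T) _).ne'
            rw [wInc, if_pos h1]; exact hT
          have a2 := hf f a1
          have a3 := wM_eq_zero (wExc_nonneg (wInc_nonneg hμ e) f) a2
          have a4 := congrFun a3 T'
          rw [wExc, if_neg h2] at a4
          exact hT' a4
      have hI : wI (wInc μ e) h = wInc μ e T * h T := by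
        unfold wI
        apply Finset.sum_eq_single T
        · intro S _ hS
          have : wInc μ e S = 0 := by by_contra hc; exact hS (huniq S hc)
          rw [this, zero_mul]
        · simp
      have hMM : wM (wInc μ e) = wInc μ e T := by
        unfold wM
        apply Finset.sum_eq_single T
        · intro S _ hS
          by_contra hc; exact hS (huniq S hc)
        · simp
      have hsub : ∀ S, wExc μ e S ≠ 0 → T.erase e ⊆ S := by
        intro S hS f hfT
        by_contra hfS
        have hfe : f ≠ e := (Finset.mem_erase.1 hfT).1
        have hfT' := (Finset.mem_erase.1 hfT).2
        have a1 : 0 < wM (wInc (wInc μ e) f) := by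
          apply (wM_pos (wInc_nonneg (wInc_nonneg hμ e) f) (S := T) _)
          rw [wInc, if_pos hfT']; exact hT
        have a2 := hf f a1.ne'
        have a3 := hR.neg hfe.symm
        rw [a2, mul_zero] at a3
        have a4 : 0 < wM (wExc (wExc μ e) f) := by
          apply (wM_pos (wExc_nonneg (wExc_nonneg hμ e) f) (S := S) _)
          rw [wExc, if_neg hfS]; exact hS
        nlinarith
      rw [hI, hMM]
      have : h T * wM (wExc μ e) ≤ wI (wExc μ e) g := by
        unfold wM wI
        rw [Finset.mul_sum]
        refine Finset.sum_le_sum fun S _ => ?_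
        by_cases hS : wExc μ e S = 0
        · rw [hS]; simp
        · rw [mul_comm]
          apply mul_le_mul_of_nonneg_left _ (wExc_nonneg hμ e S)
          exact hgh S T (wExc_ne hS).2 hTμ (wExc_ne hS).1 hTe (hsub S hS)
      have h0 := wInc_nonneg hμ e T
      nlinarith

end Dual

set_option linter.unusedSectionVars false

section Coupling
variable {ι : Type*} [Fintype ι] [DecidableEq ι]

lemma symmDiff_card_two {e : ι} {S T : Finset ι} (hc : S.card = T.card) (hS : e ∉ S) (hT : e ∈ T)
    (hsub : T.erase e ⊆ S) : (symmDiff S T).card = 2 := by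
  have h1 : T \ S = {e} := by
    ext x
    simp only [Finset.mem_sdiff, Finset.mem_singleton]
    constructor
    · rintro ⟨h1, h2⟩
      by_contra hx
      exact h2 (hsub (Finset.mem_erase.2 ⟨hx, h1⟩))
    · rintro rfl; exact ⟨hT, hS⟩
  have h2 : (S \ T).card = 1 := by
    have a := Finset.card_sdiff_add_card_inter S T
    have b := Finset.card_sdiff_add_card_inter T S
    rw [h1, Finset.inter_comm] at b
    simp at b
    omega
  have h3 : symmDiff S T = (S \ T) ∪ (T \ S) := rfl
  rw [h3, Finset.card_union_of_disjoint (disjoint_sdiff_sdiff), h2, h1]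
  simp

lemma coupling {μ : Finset ι → ℝ} (hμ : ∀ S, 0 ≤ μ S) {k : ℕ} (hk : ∀ S, μ S ≠ 0 → S.card = k)
    (hR : Ray μ) (e : ι) (h0 : 0 < wM (wExc μ e)) (h1 : 0 < wM (wInc μ e)) :
    ∃ w : Finset ι → Finset ι → ℝ, (∀ S T, 0 ≤ w S T) ∧
      (∀ S T, w S T ≠ 0 → e ∉ S ∧ e ∈ T ∧ (symmDiff S T).card = 2) ∧
      (∀ S, ∑ T, w S T = wExc μ e S / wM (wExc μ e)) ∧
      (∀ T, ∑ S, w S T = wInc μ e T / wM (wInc μ e)) := by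
  let E := {p : Finset ι × Finset ι //
    e ∉ p.1 ∧ e ∈ p.2 ∧ μ p.1 ≠ 0 ∧ μ p.2 ≠ 0 ∧ p.2.erase e ⊆ p.1}
  let L : (E → ℝ) →ₗ[ℝ] (Finset ι → ℝ) :=
    { toFun := fun a S => ∑ p : E, a p * ((if p.1.1 = S then 1 else 0) + (if p.1.2 = S then 1 else 0))
      map_add' := by
        intro a b; funext S
        simp only [Pi.add_apply, add_mul, Finset.sum_add_distrib]
      map_smul' := by
        intro c a; funext S
        simp only [Pi.smul_apply, smul_eq_mul, Finset.mul_sum, RingHom.id_apply, mul_assoc] }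
  let ν : Finset ι → ℝ := fun S => wExc μ e S / wM (wExc μ e) + wInc μ e S / wM (wInc μ e)
  have hmem : ν ∈ L '' (stdSimplex ℝ E) := by
    by_contra hν
    have hcont : Continuous L := L.continuous_of_finiteDimensional
    have hcomp : IsCompact (L '' (stdSimplex ℝ E)) := (isCompact_stdSimplex ℝ E).image hcont
    have hconv : Convex ℝ (L '' (stdSimplex ℝ E)) := (convex_stdSimplex ℝ E).linear_image L
    obtain ⟨φ, u, hφ1, hφ2⟩ := geometric_hahn_banach_point_closed hconv hcomp.isClosed hν
    let c : Finset ι → ℝ := fun S => φ (Pi.single S 1)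
    have hφ : ∀ v : Finset ι → ℝ, φ v = ∑ S, v S * c S := by
      intro v
      conv_lhs => rw [← Finset.univ_sum_single v]
      rw [map_sum]
      refine Finset.sum_congr rfl fun S _ => ?_
      have : (Pi.single S (v S) : Finset ι → ℝ) = v S • Pi.single S 1 := by
        rw [← Pi.single_smul]; simp
      rw [this, map_smul, smul_eq_mul]
    have hdual := dual_ineq _ μ le_rfl hμ k hk hR e c (fun S => u - c S) (by
      intro S T hS hT heS heT hsub
      let p : E := ⟨(S, T), heS, heT, hS, hT, hsub⟩
      have := hφ2 (L (Pi.single p 1)) ⟨_, single_mem_stdSimplex ℝ p, rfl⟩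
      have hL : ∀ R, L (Pi.single p 1) R = (if S = R then 1 else 0) + (if T = R then 1 else 0) := by
        intro R
        change ∑ q : E, (Pi.single p 1 : E → ℝ) q * _ = _
        rw [Finset.sum_eq_single p]
        · simp [p]
        · intro q _ hq; simp [hq]
        · simp
      rw [hφ] at this
      simp only [hL, add_mul, Finset.sum_add_distrib, ite_mul, one_mul, zero_mul,
        Finset.sum_ite_eq, Finset.mem_univ, if_true] at this
      linarith)
    rw [hφ] at hφ1
    have e1 : ∑ S, ν S * c S = wI (wExc μ e) c / wM (wExc μ e) + wI (wInc μ e) c / wM (wInc μ e) := by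
      simp only [wI, ν, Finset.sum_div, ← Finset.sum_add_distrib]
      refine Finset.sum_congr rfl fun S _ => ?_
      ring
    have e2 : wI (wInc μ e) (fun S => u - c S) = u * wM (wInc μ e) - wI (wInc μ e) c := by
      simp only [wI, wM, Finset.mul_sum, ← Finset.sum_sub_distrib]
      refine Finset.sum_congr rfl fun S _ => ?_
      ring
    rw [e1, div_add_div _ _ h0.ne' h1.ne', div_lt_iff₀ (by positivity)] at hφ1
    rw [e2] at hdual
    nlinarith
  obtain ⟨a, ha, haν⟩ := hmem
  have ha0 : ∀ p, 0 ≤ a p := ha.1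
  have hS' : ∀ S, ∑ p : E, a p * ((if p.1.1 = S then 1 else 0) + (if p.1.2 = S then 1 else 0)) = ν S :=
    fun S => congrFun haν S
  refine ⟨fun S T => ∑ p : E, a p * (if p.1 = (S, T) then 1 else 0), ?_, ?_, ?_, ?_⟩
  · intro S T
    refine Finset.sum_nonneg fun p _ => mul_nonneg (ha0 p) (by split_ifs <;> norm_num)
  · intro S T hST
    obtain ⟨p, _, hp⟩ := Finset.exists_ne_zero_of_sum_ne_zero hST
    have hp2 : p.1 = (S, T) := by
      by_contra hc; simp [hc] at hp
    obtain ⟨⟨S', T'⟩, q1, q2, q3, q4, q5⟩ := p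
    simp only [Prod.mk.injEq] at hp2
    obtain ⟨rfl, rfl⟩ := hp2
    exact ⟨q1, q2, symmDiff_card_two ((hk _ q3).trans (hk _ q4).symm) q1 q2 q5⟩
  · intro S
    rw [Finset.sum_comm]
    have e1 : ∀ p : E, ∑ T, a p * (if p.1 = (S, T) then (1:ℝ) else 0)
        = a p * (if p.1.1 = S then 1 else 0) := by
      intro p
      rw [← Finset.mul_sum]
      congr 1
      by_cases hp : p.1.1 = S
      · rw [if_pos hp, Finset.sum_eq_single p.1.2]
        · rw [if_pos]; rw [← hp]
        · intro T _ hT; rw [if_neg]; intro hh; exact hT (by rw [hh])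
        · simp
      · rw [if_neg hp]; apply Finset.sum_eq_zero; intro T _; rw [if_neg]
        intro hh; exact hp (by rw [hh])
    simp only [e1]
    by_cases he : e ∈ S
    · rw [Finset.sum_eq_zero]
      · simp [wExc, he]
      · intro p _; rw [if_neg, mul_zero]; rintro hh; exact p.2.1 (hh ▸ he)
    · have := hS' S
      have e3 : ν S = wExc μ e S / wM (wExc μ e) := by simp [ν, wInc, he]
      rw [← e3, ← this]
      refine Finset.sum_congr rfl fun p _ => ?_
      rw [if_neg (c := p.1.2 = S), add_zero]
      rintro hh; exact he (hh ▸ p.2.2.1)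
  · intro S
    rw [Finset.sum_comm]
    have e1 : ∀ p : E, ∑ T, a p * (if p.1 = (T, S) then (1:ℝ) else 0)
        = a p * (if p.1.2 = S then 1 else 0) := by
      intro p
      rw [← Finset.mul_sum]
      congr 1
      by_cases hp : p.1.2 = S
      · rw [if_pos hp, Finset.sum_eq_single p.1.1]
        · rw [if_pos]; rw [← hp]
        · intro T _ hT; rw [if_neg]; intro hh; exact hT (by rw [hh])
        · simp
      · rw [if_neg hp]; apply Finset.sum_eq_zero; intro T _; rw [if_neg]
        intro hh; exact hp (by rw [hh])
    simp only [e1]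
    by_cases he : e ∈ S
    · have := hS' S
      have e3 : ν S = wInc μ e S / wM (wInc μ e) := by simp [ν, wExc, he]
      rw [← e3, ← this]
      refine Finset.sum_congr rfl fun p _ => ?_
      rw [if_neg (c := p.1.1 = S), zero_add]
      rintro hh; exact p.2.1 (hh ▸ he)
    · rw [Finset.sum_eq_zero]
      · simp [wInc, he]
      · intro p _; rw [if_neg, mul_zero]; rintro hh; exact he (hh ▸ p.2.2.1)

/-- The (doubled) Dirichlet form with edge weights `min (μ S) (μ T)`. -/
noncomputable def wD (μ : Finset ι → ℝ) (f : Finset ι → ℝ) : ℝ :=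
  ∑ S, ∑ T, if (symmDiff S T).card = 2 then min (μ S) (μ T) * (f S - f T) ^ 2 else 0

lemma wD_nonneg {μ : Finset ι → ℝ} (hμ : ∀ S, 0 ≤ μ S) (f : Finset ι → ℝ) : 0 ≤ wD μ f := by
  refine Finset.sum_nonneg fun S _ => Finset.sum_nonneg fun T _ => ?_
  split_ifs
  · exact mul_nonneg (le_min (hμ S) (hμ T)) (sq_nonneg _)
  · exact le_rfl

/-- cross part of the Dirichlet form -/
noncomputable def wX (μ : Finset ι → ℝ) (e : ι) (f : Finset ι → ℝ) : ℝ :=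
  ∑ S, ∑ T, if (symmDiff S T).card = 2 ∧ e ∉ S ∧ e ∈ T then min (μ S) (μ T) * (f S - f T) ^ 2 else 0

lemma wD_split (μ : Finset ι → ℝ) (hμ : ∀ S, 0 ≤ μ S) (e : ι) (f : Finset ι → ℝ) :
    wD (wExc μ e) f + wD (wInc μ e) f + 2 * wX μ e f ≤ wD μ f := by
  have hsym : wX μ e f = ∑ S, ∑ T, if (symmDiff S T).card = 2 ∧ e ∈ S ∧ e ∉ T then
      min (μ S) (μ T) * (f S - f T) ^ 2 else 0 := by
    unfold wX
    rw [Finset.sum_comm]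
    refine Finset.sum_congr rfl fun S _ => Finset.sum_congr rfl fun T _ => ?_
    rw [symmDiff_comm, min_comm, show (f T - f S) ^ 2 = (f S - f T) ^ 2 by ring]
    by_cases h1 : e ∈ S <;> by_cases h2 : e ∈ T <;> simp [h1, h2]
  have : 2 * wX μ e f = wX μ e f + ∑ S, ∑ T, if (symmDiff S T).card = 2 ∧ e ∈ S ∧ e ∉ T then
      min (μ S) (μ T) * (f S - f T) ^ 2 else 0 := by rw [← hsym]; ring
  rw [this]
  unfold wX wD
  simp only [← Finset.sum_add_distrib]
  refine Finset.sum_le_sum fun S _ => Finset.sum_le_sum fun T _ => ?_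
  have hS := hμ S
  have hT := hμ T
  by_cases h : (symmDiff S T).card = 2 <;> by_cases h1 : e ∈ S <;> by_cases h2 : e ∈ T <;>
    simp [h, h1, h2, wInc, wExc, hS, hT]

/-- Poincare inequality for homogeneous Rayleigh weights. -/
lemma poincare (n : ℕ) : ∀ (μ : Finset ι → ℝ), (wSupp μ).card ≤ n → (∀ S, 0 ≤ μ S) →
    ∀ k : ℕ, (∀ S, μ S ≠ 0 → S.card = k) → Ray μ → ∀ (f : Finset ι → ℝ),
    wI μ (fun S => f S ^ 2) - wI μ f ^ 2 / wM μ ≤ (1 / 2) * wD μ f := by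
  induction n with
  | zero =>
    intro μ hc hμ k hk hR f
    have : ∀ S, μ S = 0 := by
      intro S
      have : wSupp μ = ∅ := by simpa using hc
      by_contra hS
      have h2 : S ∈ wSupp μ := by simpa [wSupp] using hS
      rw [this] at h2; simp at h2
    have : μ = 0 := funext this
    subst this
    simp [wI, wM, wD]
  | succ n ih =>
    intro μ hc hμ k hk hR f
    by_cases hM : wM μ = 0
    · have := wM_eq_zero hμ hM
      subst this
      simp [wI, wM, wD]
    by_cases he : ∃ e, wM (wInc μ e) ≠ 0 ∧ wM (wExc μ e) ≠ 0
    · obtain ⟨e, h1, h0⟩ := he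
      have p1 := lt_of_le_of_ne (wM_nonneg (wInc_nonneg hμ e)) h1.symm
      have p0 := lt_of_le_of_ne (wM_nonneg (wExc_nonneg hμ e)) h0.symm
      have hs1 : (wSupp (wInc μ e)).card ≤ n := by
        have := wSupp_inc_lt (wM_exists h0); omega
      have hs2 : (wSupp (wExc μ e)).card ≤ n := by
        have := wSupp_exc_lt (wM_exists h1); omega
      have ih1 := ih _ hs1 (wInc_nonneg hμ e) k (fun S hS => hk S (wInc_ne hS).2) (hR.incexc e).2 f
      have ih0 := ih _ hs2 (wExc_nonneg hμ e) k (fun S hS => hk S (wExc_ne hS).2) (hR.incexc e).1 f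
      obtain ⟨w, hw0, hw1, hw2, hw3⟩ := coupling hμ hk hR e p0 p1
      have hmean0 : wI (wExc μ e) f / wM (wExc μ e) = ∑ S, ∑ T, w S T * f S := by
        unfold wI
        rw [Finset.sum_div]
        refine Finset.sum_congr rfl fun S _ => ?_
        rw [← Finset.sum_mul, hw2]; ring
      have hmean1 : wI (wInc μ e) f / wM (wInc μ e) = ∑ S, ∑ T, w S T * f T := by
        unfold wI
        rw [Finset.sum_div, Finset.sum_comm]
        refine Finset.sum_congr rfl fun S _ => ?_
        rw [← Finset.sum_mul, hw3]; ring
      have htot : ∑ S, ∑ T, w S T = 1 := by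
        simp only [hw2]
        rw [← Finset.sum_div]; exact div_self h0
      have hjen : (wI (wExc μ e) f / wM (wExc μ e) - wI (wInc μ e) f / wM (wInc μ e)) ^ 2 ≤
          ∑ S, ∑ T, w S T * (f S - f T) ^ 2 := by
        have e1 : wI (wExc μ e) f / wM (wExc μ e) - wI (wInc μ e) f / wM (wInc μ e) =
            ∑ S, ∑ T, w S T * (f S - f T) := by
          rw [hmean0, hmean1, ← Finset.sum_sub_distrib]
          refine Finset.sum_congr rfl fun S _ => ?_
          rw [← Finset.sum_sub_distrib]
          refine Finset.sum_congr rfl fun T _ => ?_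
          ring
        rw [e1, ← Finset.sum_product', ← Finset.sum_product']
        have := Finset.sum_sq_le_sum_mul_sum_of_sq_le_mul (Finset.univ ×ˢ Finset.univ)
          (r := fun p : Finset ι × Finset ι => w p.1 p.2 * (f p.1 - f p.2))
          (f := fun p => w p.1 p.2) (g := fun p => w p.1 p.2 * (f p.1 - f p.2) ^ 2)
          (fun p _ => hw0 _ _) (fun p _ => mul_nonneg (hw0 _ _) (sq_nonneg _))
          (fun p _ => le_of_eq (by ring))
        refine this.trans (le_of_eq ?_)
        rw [Finset.sum_product' (f := fun S T => w S T), htot, one_mul]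
      set M0 := wM (wExc μ e) with hM0
      set M1 := wM (wInc μ e) with hM1
      have hMs : wM μ = M1 + M0 := wM_split μ e
      have hcross : (M0 * M1 / (M1 + M0)) * ∑ S, ∑ T, w S T * (f S - f T) ^ 2 ≤ wX μ e f := by
        unfold wX
        rw [Finset.mul_sum]
        refine Finset.sum_le_sum fun S _ => ?_
        rw [Finset.mul_sum]
        refine Finset.sum_le_sum fun T _ => ?_
        by_cases hw : w S T = 0
        · rw [hw]
          simp only [zero_mul, mul_zero]
          split_ifs
          · exact mul_nonneg (le_min (hμ S) (hμ T)) (sq_nonneg _)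
          · exact le_rfl
        · obtain ⟨q1, q2, q3⟩ := hw1 S T hw
          rw [if_pos ⟨q3, q1, q2⟩, ← mul_assoc]
          apply mul_le_mul_of_nonneg_right _ (sq_nonneg _)
          have b1 : w S T ≤ μ S / M0 := by
            have := Finset.single_le_sum (f := fun T => w S T) (fun T _ => hw0 S T) (Finset.mem_univ T)
            rw [hw2] at this
            simpa [wExc, q1] using this
          have b2 : w S T ≤ μ T / M1 := by
            have := Finset.single_le_sum (f := fun S => w S T) (fun S _ => hw0 S T) (Finset.mem_univ S)
            rw [hw3] at this
            simpa [wInc, q2] using this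
          rw [le_div_iff₀ p0] at b1
          rw [le_div_iff₀ p1] at b2
          apply le_min
          · rw [div_mul_eq_mul_div, div_le_iff₀ (by positivity)]
            nlinarith [mul_nonneg p0.le (hμ S)]
          · rw [div_mul_eq_mul_div, div_le_iff₀ (by positivity)]
            nlinarith [mul_nonneg p1.le (hμ T)]
      have hsplit := wD_split μ hμ e f
      have hvar : wI μ (fun S => f S ^ 2) - wI μ f ^ 2 / wM μ =
          (wI (wExc μ e) (fun S => f S ^ 2) - wI (wExc μ e) f ^ 2 / M0) +
          (wI (wInc μ e) (fun S => f S ^ 2) - wI (wInc μ e) f ^ 2 / M1) +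
          (M0 * M1 / (M1 + M0)) * (wI (wExc μ e) f / M0 - wI (wInc μ e) f / M1) ^ 2 := by
        rw [wI_split μ f e, wI_split μ (fun S => f S ^ 2) e, hMs]
        have : M1 + M0 ≠ 0 := by positivity
        field_simp
        ring
      have hj2 : (M0 * M1 / (M1 + M0)) * (wI (wExc μ e) f / M0 - wI (wInc μ e) f / M1) ^ 2 ≤
          (M0 * M1 / (M1 + M0)) * ∑ S, ∑ T, w S T * (f S - f T) ^ 2 := by
        gcongr
      rw [hvar]
      linarith
    · push Not at he
      obtain ⟨T, hT⟩ := wM_exists hM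
      have huniq : ∀ T', μ T' ≠ 0 → T' = T := by
        intro T' hT'
        ext f
        constructor
        · intro h1
          by_contra h2
          have a1 : wM (wInc μ f) ≠ 0 := by
            apply (wM_pos (wInc_nonneg hμ f) (S := T') _).ne'
            rw [wInc, if_pos h1]; exact hT'
          have a4 := congrFun (wM_eq_zero (wExc_nonneg hμ f) (he f a1)) T
          rw [wExc, if_neg h2] at a4
          exact hT a4
        · intro h1
          by_contra h2
          have a1 : wM (wInc μ f) ≠ 0 := by
            apply (wM_pos (wInc_nonneg hμ f) (S := T) _).ne'
            rw [wInc, if_pos h1]; exact hT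
          have a4 := congrFun (wM_eq_zero (wExc_nonneg hμ f) (he f a1)) T'
          rw [wExc, if_neg h2] at a4
          exact hT' a4
      have hI : ∀ h, wI μ h = μ T * h T := by
        intro h
        unfold wI
        apply Finset.sum_eq_single T
        · intro S _ hS
          have : μ S = 0 := by by_contra hc; exact hS (huniq S hc)
          rw [this, zero_mul]
        · simp
      rw [hI, hI, wM_eq_wI, hI]
      have : μ T * f T ^ 2 - (μ T * f T) ^ 2 / (μ T * 1) = 0 := by field_simp; ring
      rw [this]
      have := wD_nonneg hμ f
      linarith

end Coupling

set_option linter.unusedSectionVars false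

section StableRay
variable {ι : Type*} [Fintype ι] [DecidableEq ι]

/-- Complex partition function. -/
noncomputable def cZ (μ : Finset ι → ℝ) (z : ι → ℂ) : ℂ := ∑ S, (μ S : ℂ) * ∏ i ∈ S, z i

lemma cZ_scale (μ : Finset ι → ℝ) (x : ι → ℂ) (e : ι) (t : ℂ) :
    cZ μ (Function.update x e (t * x e)) = cZ (wExc μ e) x + t * cZ (wInc μ e) x := by
  simp only [cZ, Finset.mul_sum, ← Finset.sum_add_distrib]
  refine Finset.sum_congr rfl fun S _ => ?_
  by_cases h : e ∈ S
  · rw [Finset.prod_update_of_mem h, ← Finset.mul_prod_erase S x h]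
    simp only [wExc, wInc, h, if_true, Finset.sdiff_singleton_eq_erase]
    push_cast
    ring
  · rw [Finset.prod_update_of_notMem h]
    simp [wExc, wInc, h]

lemma cZ_ofReal (μ : Finset ι → ℝ) (x : ι → ℝ) : cZ μ (fun i => (x i : ℂ)) = (wZ μ x : ℂ) := by
  simp [cZ, wZ]

lemma wZ_split (μ : Finset ι → ℝ) (x : ι → ℝ) (e : ι) :
    wZ μ x = wZ (wExc μ e) x + wZ (wInc μ e) x := by
  have := wZ_scale μ x e 1
  simpa using this

lemma cZ_continuous (μ : Finset ι → ℝ) : Continuous (cZ μ) := by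
  unfold cZ; fun_prop

lemma ray_of_stable {μ : Finset ι → ℝ} (hμ : ∀ S, 0 ≤ μ S)
    (hst : ∀ z : ι → ℂ, (∀ i, 0 < (z i).im) → cZ μ z ≠ 0) : Ray μ := by
  intro x hx i j hij
  by_contra hcon
  push Not at hcon
  set A := wZ (wExc (wExc μ i) j) x with hA
  set B := wZ (wExc (wInc μ i) j) x with hB
  set C := wZ (wInc (wExc μ i) j) x with hC
  set D := wZ (wInc (wInc μ i) j) x with hD
  have e1 : wZ μ x = A + B + C + D := by
    rw [wZ_split μ x i, wZ_split (wExc μ i) x j, wZ_split (wInc μ i) x j]; ring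
  have e2 : wZ (wInc μ i) x = B + D := wZ_split _ x j
  have e3 : wZ (wInc μ j) x = C + D := by
    rw [wZ_split (wInc μ j) x i, wInc_comm μ j i, ← wInc_wExc_comm]
  rw [e1, e2, e3] at hcon
  have hAD : B * C < A * D := by nlinarith
  have hB0 : 0 ≤ B := Finset.sum_nonneg fun S _ => mul_nonneg
    (wExc_nonneg (wInc_nonneg hμ i) j S) (Finset.prod_nonneg fun k _ => (hx k).le)
  have hC0 : 0 ≤ C := Finset.sum_nonneg fun S _ => mul_nonneg
    (wInc_nonneg (wExc_nonneg hμ i) j S) (Finset.prod_nonneg fun k _ => (hx k).le)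
  have hD0 : D ≠ 0 := by
    rintro h; rw [h] at hAD; nlinarith [mul_nonneg hB0 hC0]
  let y : ℝ → ι → ℂ := fun δ k => (x k : ℂ) + δ * Complex.I
  have hy : Continuous y := by fun_prop
  have hy0 : y 0 = fun k => (x k : ℂ) := by funext k; simp [y]
  let cA := fun δ => cZ (wExc (wExc μ i) j) (y δ)
  let cB := fun δ => cZ (wExc (wInc μ i) j) (y δ)
  let cC := fun δ => cZ (wInc (wExc μ i) j) (y δ)
  let cD := fun δ => cZ (wInc (wInc μ i) j) (y δ)
  have contA : Continuous cA := (cZ_continuous _).comp hy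
  have contB : Continuous cB := (cZ_continuous _).comp hy
  have contC : Continuous cC := (cZ_continuous _).comp hy
  have contD : Continuous cD := (cZ_continuous _).comp hy
  have A0 : cA 0 = A := by simp only [cA, hy0, cZ_ofReal, hA]
  have B0 : cB 0 = B := by simp only [cB, hy0, cZ_ofReal, hB]
  have C0 : cC 0 = C := by simp only [cC, hy0, cZ_ofReal, hC]
  have D0 : cD 0 = D := by simp only [cD, hy0, cZ_ofReal, hD]
  have hden : cC 0 + Complex.I * cD 0 ≠ 0 := by
    rw [C0, D0]
    intro h
    have := congrArg Complex.im h
    simp at this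
    exact hD0 this
  let b : ℝ → ℂ := fun δ => -(cA δ + Complex.I * cB δ) / (cC δ + Complex.I * cD δ)
  have hb : ContinuousAt b 0 :=
    ContinuousAt.div (by fun_prop) (by fun_prop) hden
  have hb0 : 0 < (b 0).im := by
    simp only [b, A0, B0, C0, D0]
    have : -((A:ℂ) + Complex.I * B) / ((C:ℂ) + Complex.I * D) =
        (((-(A * C + B * D)) / (C ^ 2 + D ^ 2) : ℝ) : ℂ) +
        (((A * D - B * C) / (C ^ 2 + D ^ 2) : ℝ) : ℂ) * Complex.I := by
      have hCD : (C:ℂ) + Complex.I * D ≠ 0 := by rw [← C0, ← D0]; exact hden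
      have h2 : ((C ^ 2 + D ^ 2 : ℝ) : ℂ) ≠ 0 := by
        have : 0 < C ^ 2 + D ^ 2 := by positivity
        exact_mod_cast this.ne'
      push_cast at h2 ⊢
      rw [div_eq_iff hCD]
      field_simp
      ring_nf
      simp only [Complex.I_sq]
      ring
    rw [this]
    simp only [Complex.add_im, Complex.ofReal_im, Complex.mul_im, Complex.ofReal_re, Complex.I_im,
      Complex.I_re]
    have : 0 < (A * D - B * C) / (C ^ 2 + D ^ 2) := div_pos (by linarith) (by positivity)
    linarith
  have hden' : ∀ᶠ δ in nhds (0:ℝ), cC δ + Complex.I * cD δ ≠ 0 := by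
    have : ContinuousAt (fun δ => cC δ + Complex.I * cD δ) 0 := by fun_prop
    exact this.eventually_ne hden
  have hnum' : ∀ᶠ δ in nhds (0:ℝ), 0 < (b δ * y δ j).im := by
    have : ContinuousAt (fun δ => (b δ * y δ j).im) 0 := by
      apply Complex.continuous_im.continuousAt.comp
      exact hb.mul (by fun_prop)
    apply this.eventually_const_lt
    change 0 < (b 0 * y 0 j).im
    rw [hy0]
    simp only [Complex.mul_im, Complex.ofReal_re, Complex.ofReal_im, mul_zero, zero_add]
    exact mul_pos hb0 (hx j)
  obtain ⟨δ, ⟨hδ1, hδ2⟩, hδ0⟩ : ∃ δ : ℝ, ((cC δ + Complex.I * cD δ ≠ 0) ∧ 0 < (b δ * y δ j).im) ∧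
      0 < δ := by
    have h1 : ∀ᶠ δ in nhdsWithin (0:ℝ) (Set.Ioi 0), _ :=
      (hden'.and hnum').filter_mono nhdsWithin_le_nhds
    exact (h1.and self_mem_nhdsWithin).exists
  let z1 := Function.update (y δ) j (b δ * y δ j)
  have hz1i : z1 i = y δ i := by simp [z1, hij]
  apply hst (Function.update z1 i (Complex.I * z1 i))
  · intro k
    by_cases hk : k = i
    · subst hk
      simp only [Function.update_self, hz1i]
      simp [y]
      exact hx k
    · rw [Function.update_of_ne hk]
      by_cases hk2 : k = j
      · subst hk2; simpa [z1] using hδ2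
      · simp only [z1, Function.update_of_ne hk2]
        simp [y, hδ0]
  · rw [cZ_scale, cZ_scale, cZ_scale]
    change cA δ + b δ * cC δ + Complex.I * (cB δ + b δ * cD δ) = 0
    have : b δ * (cC δ + Complex.I * cD δ) = -(cA δ + Complex.I * cB δ) := div_mul_cancel₀ _ hδ1
    linear_combination this

end StableRay

set_option linter.unusedSectionVars false

section GWS
open Polynomial

lemma normSq_disc (w r : ℂ) (hw : 0 < w.im) (hwr : w - r ≠ 0) :
    Complex.normSq (1 / (w - r) + (1 / (2 * w.im) : ℝ) * Complex.I) =
      (1 / (2 * w.im)) ^ 2 + (r.im / w.im) / Complex.normSq (w - r) := by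
  have h1 : Complex.normSq (w - r) ≠ 0 := by simpa using hwr
  rw [Complex.normSq_apply (_ + _)]
  simp only [one_div, Complex.add_re, Complex.inv_re, Complex.add_im, Complex.inv_im,
    Complex.mul_re, Complex.mul_im, Complex.ofReal_re, Complex.ofReal_im, Complex.I_re,
    Complex.I_im, Complex.sub_re, Complex.sub_im]
  have h2 : (w.re - r.re) ^ 2 = Complex.normSq (w - r) - (w.im - r.im) ^ 2 := by
    rw [Complex.normSq_apply]; simp; ring
  generalize Complex.normSq (w - r) = n at *
  have h3 := hw.ne'
  field_simp
  ring_nf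
  have h4 : w.re ^ 2 = n - (w.im - r.im) ^ 2 + 2 * w.re * r.re - r.re ^ 2 := by linarith
  rw [h4]; ring

lemma norm_multiset_sum_disc (κ : ℝ) (m : Multiset ℂ) (h : ∀ u ∈ m, ‖u + κ * Complex.I‖ ≤ κ) :
    ‖m.sum + (m.card * κ : ℝ) * Complex.I‖ ≤ m.card * κ := by
  induction m using Multiset.induction_on with
  | empty => simp
  | cons a m ih =>
    have h1 := ih fun u hu => h u (Multiset.mem_cons_of_mem hu)
    have h2 := h a (Multiset.mem_cons_self a m)
    simp only [Multiset.sum_cons, Multiset.card_cons]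
    have : a + m.sum + (((m.card + 1 : ℕ) : ℝ) * κ : ℝ) * Complex.I =
      (a + κ * Complex.I) + (m.sum + (m.card * κ : ℝ) * Complex.I) := by push_cast; ring
    rw [this]
    refine (norm_add_le _ _).trans ?_
    have h3 : ((m.card + 1 : ℕ) : ℝ) * κ = m.card * κ + κ := by push_cast; ring
    rw [h3]
    linarith

lemma laguerre (n : ℕ) (q : ℂ[X]) (hq : q.natDegree ≤ n + 1)
    (h : ∀ w : ℂ, 0 < w.im → q.eval w ≠ 0) (y w : ℂ) (hy : 0 < y.im) (hw : 0 < w.im) :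
    ((n : ℂ) + 1) * q.eval w + (y - w) * q.derivative.eval w ≠ 0 := by
  intro h0
  have hqw := h w hw
  have hn : ((n : ℂ) + 1) ≠ 0 := by exact_mod_cast Nat.succ_ne_zero n
  have hyw : w - y ≠ 0 := by
    intro hh
    have : y - w = 0 := by linear_combination -hh
    rw [this, zero_mul, add_zero] at h0
    exact mul_ne_zero hn hqw h0
  have hs := (IsAlgClosed.splits q).eval_derivative_eq_eval_mul_sum hqw
  set L := (q.roots.map fun z ↦ 1 / (w - z)).sum with hL
  have hL2 : L = ((n : ℂ) + 1) * (1 / (w - y)) := by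
    rw [hs] at h0
    have : q.eval w * (((n : ℂ) + 1) - (w - y) * L) = 0 := by linear_combination h0
    have h3 := (mul_eq_zero.1 this).resolve_left hqw
    field_simp
    linear_combination -h3
  set κ : ℝ := 1 / (2 * w.im) with hκ
  have hκ0 : 0 < κ := by positivity
  have hroots : ∀ u ∈ q.roots.map fun z ↦ 1 / (w - z), ‖u + κ * Complex.I‖ ≤ κ := by
    intro u hu
    obtain ⟨r, hr, rfl⟩ := Multiset.mem_map.1 hu
    have hr0 : q.eval r = 0 := (Polynomial.mem_roots'.1 hr).2
    have hrim : r.im ≤ 0 := by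
      by_contra hc
      push Not at hc
      exact h r hc hr0
    have hwr : w - r ≠ 0 := by
      intro hh; rw [sub_eq_zero.1 hh] at hw; linarith
    have := normSq_disc w r hw hwr
    rw [Complex.normSq_eq_norm_sq, ← hκ] at this
    apply le_of_sq_le_sq _ hκ0.le
    rw [this]
    have : (r.im / w.im) / Complex.normSq (w - r) ≤ 0 :=
      div_nonpos_of_nonpos_of_nonneg (div_nonpos_of_nonpos_of_nonneg hrim hw.le)
        (Complex.normSq_nonneg _)
    linarith
  have hsum := norm_multiset_sum_disc κ _ hroots
  rw [← hL, Multiset.card_map] at hsum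
  have hcard : (q.roots.card : ℝ) ≤ n + 1 := by
    exact_mod_cast (Polynomial.card_roots' q).trans hq
  have hbig : ‖L + (((n : ℝ) + 1) * κ : ℝ) * Complex.I‖ ≤ ((n : ℝ) + 1) * κ := by
    have : L + (((n : ℝ) + 1) * κ : ℝ) * Complex.I = (L + (q.roots.card * κ : ℝ) * Complex.I) +
        ((((n : ℝ) + 1) - q.roots.card) * κ : ℝ) * Complex.I := by push_cast; ring
    rw [this]
    refine (norm_add_le _ _).trans ?_
    have h2 : ‖((((((n : ℝ) + 1) - q.roots.card) * κ : ℝ) : ℂ)) * Complex.I‖ =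
        (((n : ℝ) + 1) - q.roots.card) * κ := by
      rw [norm_mul, Complex.norm_I, mul_one, Complex.norm_real, Real.norm_of_nonneg]
      exact mul_nonneg (by linarith) hκ0.le
    rw [h2]; linarith
  have hsmall : ‖1 / (w - y) + κ * Complex.I‖ ≤ κ := by
    have h1 : L + (((n : ℝ) + 1) * κ : ℝ) * Complex.I =
      (((n : ℝ) + 1 : ℝ) : ℂ) * (1 / (w - y) + κ * Complex.I) := by
      rw [hL2]; push_cast; ring
    rw [h1, norm_mul, Complex.norm_real, Real.norm_of_nonneg (by positivity)] at hbig
    exact le_of_mul_le_mul_left hbig (by positivity)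
  have h3 := normSq_disc w y hw hyw
  rw [Complex.normSq_eq_norm_sq, ← hκ] at h3
  have h4 : 0 < (y.im / w.im) / Complex.normSq (w - y) :=
    div_pos (div_pos hy hw) (Complex.normSq_pos.2 hyw)
  have h5 := pow_le_pow_left₀ (norm_nonneg _) hsmall 2
  linarith

/-- polynomial with binomially normalised coefficients -/
noncomputable def binPoly (n : ℕ) (b : ℕ → ℂ) : ℂ[X] :=
  ∑ k ∈ range (n + 1), C ((n.choose k : ℂ) * b k) * X ^ k

lemma binPoly_natDegree (n : ℕ) (b : ℕ → ℂ) : (binPoly n b).natDegree ≤ n := by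
  apply Polynomial.natDegree_sum_le_of_forall_le
  intro k hk
  refine (Polynomial.natDegree_C_mul_X_pow_le _ _).trans ?_
  have := Finset.mem_range.1 hk; omega

lemma binPoly_derivative (n : ℕ) (b : ℕ → ℂ) :
    (binPoly (n + 1) b).derivative = C ((n : ℂ) + 1) * binPoly n (fun k => b (k + 1)) := by
  unfold binPoly
  rw [Polynomial.derivative_sum, Finset.sum_range_succ', Finset.mul_sum]
  simp only [Polynomial.derivative_C_mul_X_pow]
  simp only [Nat.cast_zero, mul_zero, C_0, zero_mul, add_zero]
  refine Finset.sum_congr rfl fun k _ => ?_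
  rw [← mul_assoc, ← C_mul, Nat.add_sub_cancel]
  congr 2
  have := Nat.add_one_mul_choose_eq n k
  have h2 : ((n : ℂ) + 1) * (n.choose k : ℂ) = ((n + 1).choose (k + 1) : ℂ) * ((k : ℂ) + 1) := by
    exact_mod_cast this
  push_cast
  linear_combination (-b (k + 1)) * h2

lemma binPoly_pascal (n : ℕ) (b : ℕ → ℂ) :
    binPoly (n + 1) b = binPoly n b + X * binPoly n (fun k => b (k + 1)) := by
  unfold binPoly
  rw [Finset.sum_range_succ' _ (n + 1)]
  have h1 : ∑ k ∈ range (n + 1), C ((n.choose k : ℂ) * b k) * X ^ k =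
      ∑ k ∈ range (n + 1 + 1), C ((n.choose k : ℂ) * b k) * X ^ k := by
    rw [Finset.sum_range_succ _ (n + 1)]; simp
  rw [h1, Finset.sum_range_succ' _ (n + 1), Finset.mul_sum, add_right_comm,
    ← Finset.sum_add_distrib]
  congr 1
  · refine Finset.sum_congr rfl fun k _ => ?_
    rw [Nat.choose_succ_succ]
    push_cast
    simp only [add_mul, C_add]
    ring
  · simp

lemma gws {α : Type*} [DecidableEq α] (s : Finset α) : ∀ b : ℕ → ℂ,
    (∀ w : ℂ, 0 < w.im → (binPoly s.card b).eval w ≠ 0) →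
    ∀ y : α → ℂ, (∀ i ∈ s, 0 < (y i).im) →
    ∑ T ∈ s.powerset, b T.card * ∏ i ∈ T, y i ≠ 0 := by
  induction s using Finset.induction_on with
  | empty =>
    intro b hb y _
    have := hb Complex.I (by simp)
    simpa [binPoly] using this
  | insert a s ha ih =>
    intro b hb y hy
    have h1 : ∑ T ∈ (insert a s).powerset, b T.card * ∏ i ∈ T, y i =
        ∑ T ∈ s.powerset, (fun k => b k + y a * b (k + 1)) T.card * ∏ i ∈ T, y i := by
      rw [Finset.sum_powerset_insert ha, ← Finset.sum_add_distrib]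
      refine Finset.sum_congr rfl fun T hT => ?_
      have haT : a ∉ T := fun h => ha (Finset.mem_powerset.1 hT h)
      rw [Finset.card_insert_of_notMem haT, Finset.prod_insert haT]
      ring
    rw [h1]
    refine ih (fun k => b k + y a * b (k + 1)) ?_ y fun i hi => hy i (Finset.mem_insert_of_mem hi)
    intro w hw h0
    rw [Finset.card_insert_of_notMem ha] at hb
    have := laguerre s.card _ (binPoly_natDegree _ b) hb (y a) w (hy a (Finset.mem_insert_self a s)) hw
    apply this
    rw [binPoly_derivative, binPoly_pascal]
    have h2 : (binPoly s.card (fun k => b k + y a * b (k + 1))).eval w =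
        (binPoly s.card b).eval w + y a * (binPoly s.card (fun k => b (k + 1))).eval w := by
      simp only [binPoly, Polynomial.eval_finset_sum, Finset.mul_sum, ← Finset.sum_add_distrib]
      refine Finset.sum_congr rfl fun k _ => ?_
      simp; ring
    rw [h2] at h0
    simp only [eval_add, eval_mul, eval_X, eval_C]
    linear_combination ((s.card : ℂ) + 1) * h0

end GWS

set_option linter.unusedSectionVars false

section Homotopy
open Polynomial

lemma prod_sub_lower (s : ℂ) (ρ : ℝ) (hρ : 0 ≤ ρ) (m : Multiset ℂ) (h : ∀ r ∈ m, ρ ≤ ‖s - r‖) :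
    ρ ^ m.card ≤ ‖(m.map (s - ·)).prod‖ := by
  induction m using Multiset.induction_on with
  | empty => simp
  | cons a m ih =>
    have h1 := ih fun u hu => h u (Multiset.mem_cons_of_mem hu)
    have h2 := h a (Multiset.mem_cons_self a m)
    simp only [Multiset.map_cons, Multiset.prod_cons, Multiset.card_cons, norm_mul, pow_succ']
    gcongr

lemma prod_sub_lower2 (m : Multiset ℂ) (h : ∀ r ∈ m, 0 < r.im) :
    ∃ K : ℝ, 0 < K ∧ ∀ t : ℂ, t.im ≤ 0 → K * (1 + ‖t‖) ^ m.card ≤ ‖(m.map (t - ·)).prod‖ := by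
  induction m using Multiset.induction_on with
  | empty => exact ⟨1, one_pos, by simp⟩
  | cons a m ih =>
    obtain ⟨K, hK, h1⟩ := ih fun u hu => h u (Multiset.mem_cons_of_mem hu)
    have h2 := h a (Multiset.mem_cons_self a m)
    have hc : 0 < (1 + ‖a‖) / a.im + 1 := by positivity
    refine ⟨1 / ((1 + ‖a‖) / a.im + 1) * K, by positivity, fun t ht => ?_⟩
    simp only [Multiset.map_cons, Multiset.prod_cons, Multiset.card_cons, norm_mul, pow_succ']
    have h3 : 1 / ((1 + ‖a‖) / a.im + 1) * (1 + ‖t‖) ≤ ‖t - a‖ := by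
      rw [one_div_mul_eq_div, div_le_iff₀ hc]
      have e1 : a.im ≤ ‖t - a‖ := by
        have := Complex.abs_im_le_norm (t - a)
        rw [Complex.sub_im] at this
        have := neg_abs_le (t.im - a.im)
        linarith
      have e2 : ‖t‖ ≤ ‖t - a‖ + ‖a‖ := by
        have := norm_add_le (t - a) a
        simpa using this
      have e3 : (1 + ‖a‖) ≤ ‖t - a‖ * ((1 + ‖a‖) / a.im) := by
        rw [mul_div_assoc', le_div_iff₀ h2]
        nlinarith [norm_nonneg a]
      linarith
    calc 1 / ((1 + ‖a‖) / a.im + 1) * K * ((1 + ‖t‖) * (1 + ‖t‖) ^ m.card)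
        = (1 / ((1 + ‖a‖) / a.im + 1) * (1 + ‖t‖)) * (K * (1 + ‖t‖) ^ m.card) := by ring
      _ ≤ _ := by
        gcongr
        exact h1 t ht

lemma homotopy {X : Type*} [TopologicalSpace X] [PreconnectedSpace X] (F : X → ℂ[X]) (N : ℕ)
    (hdeg : ∀ x, (F x).natDegree ≤ N) (hcont : ∀ k, Continuous fun x => (F x).coeff k)
    (hlead : ∀ x, (F x).coeff N ≠ 0) (hreal : ∀ x, ∀ t : ℝ, (F x).eval (t : ℂ) ≠ 0)
    (x0 : X) (h0 : ∀ t : ℂ, t.im < 0 → (F x0).eval t ≠ 0) (x : X) (t : ℂ) (ht : t.im < 0) :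
    (F x).eval t ≠ 0 := by
  have hnd : ∀ x, (F x).natDegree = N := fun x =>
    le_antisymm (hdeg x) (Polynomial.le_natDegree_of_ne_zero (hlead x))
  have hcard : ∀ x, (F x).roots.card = N := fun x => by
    rw [← (IsAlgClosed.splits (F x)).natDegree_eq_card_roots, hnd]
  have hne : ∀ x, F x ≠ 0 := fun x hx => hlead x (by rw [hx]; simp)
  have heval : ∀ x t, (F x).eval t = (F x).coeff N * ((F x).roots.map (t - ·)).prod := by
    intro x t
    rw [(IsAlgClosed.splits (F x)).eval_eq_prod_roots, Polynomial.leadingCoeff, hnd]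
  have hevs : ∀ x t, (F x).eval t = ∑ k ∈ range (N + 1), (F x).coeff k * t ^ k := fun x t =>
    Polynomial.eval_eq_sum_range' (Nat.lt_succ_of_le (hdeg x)) t
  let Λ : Set X := {x | ∃ t : ℂ, t.im < 0 ∧ (F x).eval t = 0}
  have hopen : IsOpen Λ := by
    rw [isOpen_iff_mem_nhds]
    rintro x1 ⟨t, ht, hx1⟩
    have hc1 : Continuous fun x => ‖(F x).coeff N‖ * (-t.im) ^ N - ‖(F x).eval t‖ := by
      simp only [hevs]; fun_prop
    have hpos : 0 < ‖(F x1).coeff N‖ * (-t.im) ^ N - ‖(F x1).eval t‖ := by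
      rw [hx1, norm_zero, sub_zero]
      exact mul_pos (norm_pos_iff.2 (hlead x1)) (pow_pos (by linarith) _)
    filter_upwards [hc1.continuousAt.eventually_const_lt hpos] with x hx
    by_contra hcon
    have hall : ∀ r ∈ (F x).roots, -t.im ≤ ‖t - r‖ := by
      intro r hr
      have hr0 : (F x).eval r = 0 := (Polynomial.mem_roots'.1 hr).2
      have : 0 ≤ r.im := by
        by_contra hc
        push Not at hc
        exact hcon ⟨r, hc, hr0⟩
      have h1 := Complex.abs_im_le_norm (t - r)
      rw [Complex.sub_im] at h1
      have := neg_abs_le (t.im - r.im)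
      linarith
    have := prod_sub_lower t (-t.im) (by linarith) _ hall
    rw [hcard] at this
    rw [heval, norm_mul] at hx
    have h2 := mul_le_mul_of_nonneg_left this (norm_nonneg ((F x).coeff N))
    linarith
  have hclosed : IsClosed Λ := by
    rw [← isOpen_compl_iff, isOpen_iff_mem_nhds]
    intro x1 hx1
    have hroots : ∀ r ∈ (F x1).roots, 0 < r.im := by
      intro r hr
      have hr0 : (F x1).eval r = 0 := (Polynomial.mem_roots'.1 hr).2
      by_contra hc
      push Not at hc
      rcases hc.lt_or_eq with h | h
      · exact hx1 ⟨r, h, hr0⟩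
      · apply hreal x1 r.re
        have : (r.re : ℂ) = r := by apply Complex.ext <;> simp [h]
        rw [this, hr0]
    obtain ⟨K, hK, hKb⟩ := prod_sub_lower2 _ hroots
    rw [hcard] at hKb
    have hc1 : Continuous fun x => ‖(F x1).coeff N‖ * K -
        ∑ k ∈ range (N + 1), ‖(F x1).coeff k - (F x).coeff k‖ := by fun_prop
    have hpos : 0 < ‖(F x1).coeff N‖ * K -
        ∑ k ∈ range (N + 1), ‖(F x1).coeff k - (F x1).coeff k‖ := by
      simp only [sub_self, norm_zero, Finset.sum_const_zero, sub_zero]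
      exact mul_pos (norm_pos_iff.2 (hlead x1)) hK
    filter_upwards [hc1.continuousAt.eventually_const_lt hpos] with x hx
    rintro ⟨t, ht, hxt⟩
    have h1 : ‖(F x1).eval t‖ ≤
        (∑ k ∈ range (N + 1), ‖(F x1).coeff k - (F x).coeff k‖) * (1 + ‖t‖) ^ N := by
      rw [← sub_zero ((F x1).eval t), ← hxt, hevs, hevs, ← Finset.sum_sub_distrib, Finset.sum_mul]
      refine (norm_sum_le _ _).trans (Finset.sum_le_sum fun k hk => ?_)
      rw [← sub_mul, norm_mul, norm_pow]
      gcongr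
      calc ‖t‖ ^ k ≤ (1 + ‖t‖) ^ k := by gcongr; linarith
        _ ≤ (1 + ‖t‖) ^ N := pow_le_pow_right₀ (by linarith [norm_nonneg t])
          (by have := Finset.mem_range.1 hk; omega)
    rw [heval, norm_mul] at h1
    have h2 := mul_le_mul_of_nonneg_left (hKb t ht.le) (norm_nonneg ((F x1).coeff N))
    have h3 : 0 < (1 + ‖t‖) ^ N := by positivity
    nlinarith
  rcases isClopen_iff.1 ⟨hclosed, hopen⟩ with h | h
  · intro hx
    have : x ∈ Λ := ⟨t, ht, hx⟩
    rw [h] at this; exact this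
  · have : x0 ∈ Λ := by rw [h]; trivial
    obtain ⟨t, ht, hx⟩ := this
    exact absurd hx (h0 t ht)

variable {ι : Type*} [Fintype ι] [DecidableEq ι]

lemma cZ_conj (μ : Finset ι → ℝ) (z : ι → ℂ) :
    cZ μ (fun i => (starRingEnd ℂ) (z i)) = (starRingEnd ℂ) (cZ μ z) := by
  simp [cZ, map_sum, map_mul, map_prod]

lemma stable_neg {μ : Finset ι → ℝ} (hst : ∀ z : ι → ℂ, (∀ i, 0 < (z i).im) → cZ μ z ≠ 0)
    (z : ι → ℂ) (hz : ∀ i, (z i).im < 0) : cZ μ z ≠ 0 := by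
  intro h
  apply hst (fun i => (starRingEnd ℂ) (z i)) (fun i => by simpa using hz i)
  rw [cZ_conj, h, map_zero]

/-- Stability of the homogenization. -/
lemma stable_homog {μ : Finset ι → ℝ} (hμ : ∀ S, 0 < μ S)
    (hst : ∀ z : ι → ℂ, (∀ i, 0 < (z i).im) → cZ μ z ≠ 0)
    (v : ι → ℂ) (hv : ∀ i, 0 < (v i).im) (t : ℂ) (ht : t.im < 0) :
    cZ μ (fun i => t * v i) ≠ 0 := by
  let U : Set (ι → ℂ) := {v | ∀ i, 0 < (v i).im}
  have hU : Convex ℝ U := by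
    intro x hx y hy a b ha hb hab i
    simp only [Pi.add_apply, Pi.smul_apply, Complex.add_im, Complex.smul_im, smul_eq_mul]
    have h1 := hx i
    have h2 := hy i
    rcases ha.eq_or_lt with h | h
    · have : b = 1 := by linarith
      rw [← h, this]; simpa using h2
    · have := mul_pos h h1
      have := mul_nonneg hb h2.le
      linarith
  haveI : PreconnectedSpace U := Subtype.preconnectedSpace hU.isPreconnected
  let F : U → ℂ[X] := fun v => ∑ S : Finset ι, C ((μ S : ℂ) * ∏ i ∈ S, v.1 i) * X ^ S.card
  have hF : ∀ (v : U) (t : ℂ), (F v).eval t = cZ μ (fun i => t * v.1 i) := by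
    intro v t
    simp only [F, cZ, eval_finset_sum, eval_mul, eval_C, eval_pow, eval_X, Finset.prod_mul_distrib,
      Finset.prod_const]
    refine Finset.sum_congr rfl fun S _ => ?_
    ring
  have hco : ∀ (v : U) k, (F v).coeff k =
      ∑ S : Finset ι, if k = S.card then (μ S : ℂ) * ∏ i ∈ S, v.1 i else 0 := by
    intro v k
    simp only [F, finset_sum_coeff, coeff_C_mul_X_pow]
  have := homotopy F (Fintype.card ι) (by
      intro v
      apply Polynomial.natDegree_sum_le_of_forall_le
      intro S _
      exact (Polynomial.natDegree_C_mul_X_pow_le _ _).trans (Finset.card_le_univ S)) (by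
      intro k
      simp only [hco]
      apply continuous_finset_sum
      intro S _
      split_ifs
      · fun_prop
      · fun_prop) (by
      intro v
      rw [hco, Finset.sum_eq_single Finset.univ]
      · rw [if_pos (by simp)]
        apply mul_ne_zero
        · exact_mod_cast (hμ _).ne'
        · apply Finset.prod_ne_zero_iff.2
          intro i _ h
          have := v.2 i
          rw [h] at this; simp at this
      · intro S _ hS
        rw [if_neg]
        intro h
        exact hS ((Finset.card_eq_iff_eq_univ S).1 h.symm)
      · simp) (by
      intro v t
      rw [hF]
      rcases lt_trichotomy t 0 with h | h | h
      · apply stable_neg hst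
        intro i
        simpa using mul_neg_of_neg_of_pos h (v.2 i)
      · subst h
        simp only [Complex.ofReal_zero, zero_mul, cZ]
        rw [Finset.sum_eq_single ∅]
        · simpa using (hμ ∅).ne'
        · intro S _ hS
          obtain ⟨i, hi⟩ := Finset.nonempty_iff_ne_empty.2 hS
          rw [Finset.prod_eq_zero hi rfl, mul_zero]
        · simp
      · apply hst
        intro i
        simpa using mul_pos h (v.2 i))
      ⟨fun _ => Complex.I, fun i => by simp⟩ (by
      intro t ht
      rw [hF]
      rcases lt_trichotomy t.re 0 with h | h | h
      · apply stable_neg hst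
        intro i
        simpa using h
      · have : t * Complex.I = ((-t.im : ℝ) : ℂ) := by
          apply Complex.ext <;> simp [h]
        simp only [this]
        rw [cZ_ofReal]
        have : 0 < wZ μ (fun _ : ι => -t.im) := by
          apply Finset.sum_pos
          · intro S _
            exact mul_pos (hμ S) (Finset.prod_pos fun i _ => by linarith)
          · exact Finset.univ_nonempty
        exact_mod_cast this.ne'
      · apply hst
        intro i
        simpa using h) ⟨v, hv⟩ t ht
  rw [hF] at this
  exact this

end Homotopy

set_option linter.unusedSectionVars false

section Glue

/-- The identification of two copies of `[N]` with `[2N]`. -/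
def halfEquiv (N : ℕ) : Fin N ⊕ Fin N ≃ Fin (2 * N) :=
  finSumFinEquiv.trans (finCongr (by omega))

/-- Glue a subset of the first half and a subset of the second half. -/
def glue (N : ℕ) (S R : Finset (Fin N)) : Finset (Fin (2 * N)) :=
  (S.disjSum R).map (halfEquiv N).toEmbedding

lemma sum_glue {M : Type*} [AddCommMonoid M] (N : ℕ) (F : Finset (Fin (2 * N)) → M) :
    ∑ T, F T = ∑ S, ∑ R, F (glue N S R) := by
  rw [← Fintype.sum_prod_type' (f := fun S R => F (glue N S R))]
  symm
  refine Fintype.sum_equiv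
    ((Finset.sumEquiv (α := Fin N) (β := Fin N)).toEquiv.symm.trans (halfEquiv N).finsetCongr) _ _ ?_
  rintro ⟨S, R⟩
  simp [glue, Finset.sumEquiv]

lemma halfEquiv_inl (N : ℕ) (i : Fin N) :
    halfEquiv N (Sum.inl i) = Fin.castLE (by omega) i := by
  ext; simp [halfEquiv]

lemma restrictDown_glue (N : ℕ) (S R : Finset (Fin N)) : restrictDown N (glue N S R) = S := by
  ext i
  rw [restrictDown, Finset.mem_filter, ← halfEquiv_inl, glue, ← Equiv.coe_toEmbedding,
    Finset.mem_map']
  simp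

lemma card_glue (N : ℕ) (S R : Finset (Fin N)) : (glue N S R).card = S.card + R.card := by
  simp [glue]

lemma prod_glue {M : Type*} [CommMonoid M] (N : ℕ) (S R : Finset (Fin N)) (z : Fin (2 * N) → M) :
    ∏ i ∈ glue N S R, z i =
      (∏ i ∈ S, z (halfEquiv N (Sum.inl i))) * ∏ i ∈ R, z (halfEquiv N (Sum.inr i)) := by
  simp [glue, Finset.prod_map]

lemma symmHom_glue (N : ℕ) (π : Finset (Fin N) → ℝ) (S R : Finset (Fin N)) :
    symmHom N π (glue N S R) =
      if S.card + R.card = N then π S / (N.choose S.card : ℝ) else 0 := by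
  simp only [symmHom, restrictDown_glue, card_glue]

lemma card_le_N {N : ℕ} (S : Finset (Fin N)) : S.card ≤ N := by
  simpa using Finset.card_le_univ S

lemma symmHom_sum (N : ℕ) (π : Finset (Fin N) → ℝ) : ∑ T, symmHom N π T = ∑ S, π S := by
  rw [sum_glue]
  refine Finset.sum_congr rfl fun S _ => ?_
  simp only [symmHom_glue]
  have hS := card_le_N S
  rw [← Finset.sum_filter, Finset.sum_const]
  have : (Finset.univ.filter fun R : Finset (Fin N) => S.card + R.card = N)
      = Finset.powersetCard (N - S.card) Finset.univ := by
    ext R; simp [Finset.mem_powersetCard]; omega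
  rw [this, Finset.card_powersetCard, Finset.card_univ, Fintype.card_fin, Nat.choose_symm hS,
    nsmul_eq_mul]
  have h0 : (N.choose S.card : ℝ) ≠ 0 := by exact_mod_cast (Nat.choose_pos hS).ne'
  field_simp

lemma symmHom_nonneg (N : ℕ) (π : Finset (Fin N) → ℝ) (h : ∀ S, 0 ≤ π S) (T) :
    0 ≤ symmHom N π T := by
  unfold symmHom; split_ifs
  · exact div_nonneg (h _) (Nat.cast_nonneg _)
  · exact le_rfl

open Polynomial in
lemma symmHom_stable_pos (N : ℕ) (π : Finset (Fin N) → ℝ) (h : ∀ S, 0 < π S)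
    (hst : ∀ z : Fin N → ℂ, (∀ i, 0 < (z i).im) → cZ π z ≠ 0)
    (z : Fin (2 * N) → ℂ) (hz : ∀ i, 0 < (z i).im) : cZ (symmHom N π) z ≠ 0 := by
  set u : Fin N → ℂ := fun i => z (halfEquiv N (Sum.inl i)) with hu
  set y : Fin N → ℂ := fun i => z (halfEquiv N (Sum.inr i)) with hy
  set b : ℕ → ℂ := fun r => ∑ S : Finset (Fin N),
    if S.card + r = N then ((π S / (N.choose S.card : ℝ) : ℝ) : ℂ) * ∏ i ∈ S, u i else 0 with hb
  have e1 : cZ (symmHom N π) z = ∑ R ∈ (Finset.univ : Finset (Fin N)).powerset,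
      b R.card * ∏ i ∈ R, y i := by
    rw [cZ, sum_glue, Finset.sum_comm, Finset.powerset_univ]
    refine Finset.sum_congr rfl fun R _ => ?_
    rw [hb, Finset.sum_mul]
    refine Finset.sum_congr rfl fun S _ => ?_
    rw [symmHom_glue, prod_glue]
    split_ifs
    · simp only [hu, hy]; ring
    · simp
  rw [e1]
  refine gws _ b ?_ y (fun i _ => hz _)
  intro w hw
  have hw0 : w ≠ 0 := by rintro rfl; simp at hw
  have e2 : (binPoly (Finset.univ : Finset (Fin N)).card b).eval w
      = w ^ N * cZ π (fun i => w⁻¹ * u i) := by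
    rw [Finset.card_univ, Fintype.card_fin, binPoly, Polynomial.eval_finsetSum]
    simp only [eval_mul, eval_C, eval_pow, eval_X, hb, cZ, Finset.mul_sum, Finset.sum_mul]
    rw [Finset.sum_comm]
    refine Finset.sum_congr rfl fun S _ => ?_
    have hS := card_le_N S
    rw [Finset.sum_eq_single (N - S.card)]
    · rw [if_pos (by omega), Nat.choose_symm hS, Finset.prod_mul_distrib, Finset.prod_const]
      have h0 : (N.choose S.card : ℂ) ≠ 0 := by exact_mod_cast (Nat.choose_pos hS).ne'
      have : w ^ N = w ^ (N - S.card) * w ^ S.card := by rw [← pow_add]; congr 1; omega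
      rw [this, inv_pow]
      push_cast
      field_simp
    · intro k _ hk
      rw [if_neg (by omega)]; simp
    · intro hk; simp at hk
  rw [e2]
  refine mul_ne_zero (pow_ne_zero _ hw0) (stable_homog h hst u (fun i => hz _) _ ?_)
  rw [Complex.inv_im]
  exact div_neg_of_neg_of_pos (by linarith) (Complex.normSq_pos.2 hw0)

/-- Noise perturbation of a weight. -/
noncomputable def noise {N : ℕ} (π : Finset (Fin N) → ℝ) (δ : ℝ) (S : Finset (Fin N)) : ℝ :=
  ∑ R, π R * δ ^ (symmDiff R S).card

lemma noise_pos {N : ℕ} (π : Finset (Fin N) → ℝ) (h : ∀ S, 0 ≤ π S) (h1 : ∑ S, π S = 1)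
    {δ : ℝ} (hδ : 0 < δ) (S) : 0 < noise π δ S := by
  obtain ⟨R, hR⟩ : ∃ R, 0 < π R := by
    by_contra hc
    push Not at hc
    have := Finset.sum_nonpos (s := Finset.univ) fun S _ => hc S
    linarith
  exact Finset.sum_pos' (fun R _ => mul_nonneg (h R) (by positivity))
    ⟨R, Finset.mem_univ _, by positivity⟩

lemma noise_zero {N : ℕ} (π : Finset (Fin N) → ℝ) : noise π 0 = π := by
  funext S
  unfold noise
  rw [Finset.sum_eq_single S]
  · simp
  · intro R _ hR
    rw [zero_pow]; · simp
    simpa [Finset.card_eq_zero, symmDiff_eq_bot] using hR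
  · simp

lemma noise_prod {N : ℕ} (R : Finset (Fin N)) (δ : ℂ) (z : Fin N → ℂ) :
    ∑ S : Finset (Fin N), δ ^ (symmDiff R S).card * ∏ i ∈ S, z i
      = ∏ i, (if i ∈ R then z i + δ else 1 + δ * z i) := by
  have : ∀ i, (if i ∈ R then z i + δ else 1 + δ * z i)
      = (if i ∈ R then z i else δ * z i) + (if i ∈ R then δ else 1) := by
    intro i; split_ifs <;> ring
  simp only [this]
  rw [Finset.prod_add, Finset.powerset_univ]
  refine Finset.sum_congr rfl fun S _ => ?_
  have e1 : ∏ i ∈ S, (if i ∈ R then z i else δ * z i) = δ ^ (S \ R).card * ∏ i ∈ S, z i := by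
    have : ∀ i, (if i ∈ R then z i else δ * z i) = (if i ∈ R then 1 else δ) * z i := by
      intro i; split_ifs <;> ring
    simp only [this]
    rw [Finset.prod_mul_distrib, Finset.prod_ite]
    simp only [Finset.prod_const, one_pow, one_mul]
    congr 3
    ext i; simp
  have e2 : ∏ i ∈ Finset.univ \ S, (if i ∈ R then δ else 1) = δ ^ (R \ S).card := by
    rw [Finset.prod_ite]
    simp only [Finset.prod_const, one_pow, mul_one]
    congr 2
    ext i; simp [and_comm]
  rw [e1, e2]
  have e3 : (symmDiff R S).card = (S \ R).card + (R \ S).card := by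
    rw [symmDiff_def, Finset.sup_eq_union, Finset.card_union_of_disjoint, add_comm]
    exact disjoint_sdiff_sdiff
  rw [e3, pow_add]; ring

lemma noise_stable {N : ℕ} (π : Finset (Fin N) → ℝ) {δ : ℝ} (h0 : 0 < δ) (h1 : δ < 1)
    (hst : ∀ z : Fin N → ℂ, (∀ i, 0 < (z i).im) → cZ π z ≠ 0)
    (z : Fin N → ℂ) (hz : ∀ i, 0 < (z i).im) : cZ (noise π δ) z ≠ 0 := by
  have hne : ∀ i, 1 + (δ : ℂ) * z i ≠ 0 := by
    intro i hi
    have := congrArg Complex.im hi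
    simp at this
    rcases this with h | h
    · exact h0.ne' h
    · exact (hz i).ne' h
  have e : cZ (noise π δ) z
      = (∏ i, (1 + (δ : ℂ) * z i)) * cZ π (fun i => (z i + δ) / (1 + δ * z i)) := by
    simp only [cZ, noise]
    push_cast
    simp only [Finset.sum_mul, Finset.mul_sum]
    rw [Finset.sum_comm]
    refine Finset.sum_congr rfl fun R _ => ?_
    have := noise_prod R (δ : ℂ) z
    calc ∑ S : Finset (Fin N), (π R : ℂ) * (δ : ℂ) ^ (symmDiff R S).card * ∏ i ∈ S, z i
        = (π R : ℂ) * ∏ i, (if i ∈ R then z i + δ else 1 + δ * z i) := by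
          rw [← this, Finset.mul_sum]
          exact Finset.sum_congr rfl fun S _ => by ring
      _ = (π R : ℂ) * ((∏ i, (1 + (δ : ℂ) * z i)) * ∏ i ∈ R, (z i + δ) / (1 + δ * z i)) := by
          congr 1
          rw [← Finset.prod_filter_mul_prod_filter_not Finset.univ (· ∈ R)
            (fun i => (1 + (δ : ℂ) * z i)), Finset.prod_ite]
          have : (Finset.univ.filter fun i => i ∈ R) = R := by ext; simp
          rw [this, mul_right_comm, ← Finset.prod_mul_distrib]
          congr 1
          refine Finset.prod_congr rfl fun i _ => ?_
          rw [mul_div_cancel₀ _ (hne i)]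
      _ = _ := by ring
  rw [e]
  refine mul_ne_zero (Finset.prod_ne_zero_iff.2 fun i _ => hne i) (hst _ fun i => ?_)
  rw [Complex.div_im]
  have hn : 0 < Complex.normSq (1 + (δ : ℂ) * z i) := Complex.normSq_pos.2 (hne i)
  rw [← sub_div]
  refine div_pos ?_ hn
  simp
  nlinarith [mul_pos (hz i) (by nlinarith : 0 < 1 - δ ^ 2)]

lemma symmHom_ray (N : ℕ) (π : Finset (Fin N) → ℝ) (h : ∀ S, 0 ≤ π S) (h1 : ∑ S, π S = 1)
    (hst : ∀ z : Fin N → ℂ, (∀ i, 0 < (z i).im) → cZ π z ≠ 0) : Ray (symmHom N π) := by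
  intro x hx i j hij
  have hcs : ∀ T, Continuous fun δ : ℝ => symmHom N (noise π δ) T := by
    intro T
    unfold symmHom noise
    split_ifs
    · fun_prop
    · fun_prop
  have hc : ∀ c : Finset (Fin (2 * N)) → Prop, Continuous fun δ : ℝ =>
      ∑ T, (if c T then symmHom N (noise π δ) T else 0) * ∏ i ∈ T, x i := by
    intro c
    refine continuous_finsetSum _ fun T _ => ?_
    split_ifs
    · exact (hcs T).mul continuous_const
    · fun_prop
  have c0 : Continuous fun δ : ℝ => wZ (symmHom N (noise π δ)) x :=
    continuous_finsetSum _ fun T _ => (hcs T).mul continuous_const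
  have ci : ∀ i, Continuous fun δ : ℝ => wZ (wInc (symmHom N (noise π δ)) i) x := fun i => by
    simpa [wZ, wInc] using hc (fun T => i ∈ T)
  have cij : Continuous fun δ : ℝ => wZ (wInc (wInc (symmHom N (noise π δ)) i) j) x := by
    have := hc (fun T => j ∈ T ∧ i ∈ T)
    simpa [wZ, wInc, ite_and] using this
  have key : ∀ δ ∈ Set.Ioo (0:ℝ) 1,
      wZ (symmHom N (noise π δ)) x * wZ (wInc (wInc (symmHom N (noise π δ)) i) j) x
        ≤ wZ (wInc (symmHom N (noise π δ)) i) x * wZ (wInc (symmHom N (noise π δ)) j) x := by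
    intro δ hδ
    have hp := noise_pos π h h1 hδ.1
    exact ray_of_stable (symmHom_nonneg N _ fun S => (hp S).le)
      (symmHom_stable_pos N _ hp (noise_stable π hδ.1 hδ.2 hst)) x hx i j hij
  have l1 := ((c0.mul cij).tendsto 0).mono_left (nhdsWithin_le_nhds (s := Set.Ioi 0))
  have l2 := (((ci i).mul (ci j)).tendsto 0).mono_left (nhdsWithin_le_nhds (s := Set.Ioi 0))
  have := le_of_tendsto_of_tendsto l1 l2 (by
    filter_upwards [Ioo_mem_nhdsGT (zero_lt_one' ℝ)] with δ hδ using key δ hδ)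
  simpa only [Pi.mul_apply, noise_zero] using this

end Glue

set_option linter.unusedSectionVars false

section Mixing
variable {Ω : Type*} [Fintype Ω] [DecidableEq Ω]

lemma dirichlet_expand (K : Ω → Ω → ℝ) (m : Ω → ℝ) (hs : ∀ x y, K x y = K y x)
    (hm : ∀ x, ∑ y, K x y = m x) (σ : ℝ) (hσ : σ ^ 2 = 1) (f : Ω → ℝ) :
    ∑ x, ∑ y, K x y * (f x + σ * f y) ^ 2
      = 2 * ∑ x, m x * f x ^ 2 + 2 * σ * ∑ x, ∑ y, K x y * f x * f y := by
  have e1 : ∑ x, ∑ y, K x y * f x ^ 2 = ∑ x, m x * f x ^ 2 := by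
    refine Finset.sum_congr rfl fun x _ => ?_
    rw [← hm, Finset.sum_mul]
  have e2 : ∑ x, ∑ y, K x y * f y ^ 2 = ∑ x, m x * f x ^ 2 := by
    rw [Finset.sum_comm, ← e1]
    refine Finset.sum_congr rfl fun x _ => Finset.sum_congr rfl fun y _ => ?_
    rw [hs]
  have e3 : ∑ x, ∑ y, K x y * (f x + σ * f y) ^ 2 = ∑ x, ∑ y, K x y * f x ^ 2 +
      ∑ x, ∑ y, K x y * f y ^ 2 + 2 * σ * ∑ x, ∑ y, K x y * f x * f y := by
    simp only [Finset.mul_sum, ← Finset.sum_add_distrib]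
    refine Finset.sum_congr rfl fun x _ => Finset.sum_congr rfl fun y _ => ?_
    have : K x y * (f x + σ * f y) ^ 2 = K x y * f x ^ 2 + σ ^ 2 * (K x y * f y ^ 2)
      + 2 * σ * (K x y * f x * f y) := by ring
    rw [this, hσ]; ring
  rw [e3, e1, e2]; ring

lemma psd_of_lazy (P : Matrix Ω Ω ℝ) (μ : Ω → ℝ) (hμ : ∀ x, 0 < μ x)
    (hrev : ∀ x y, μ x * P x y = μ y * P y x) (hrow : ∀ x, ∑ y, P x y = 1)
    (hoff : ∀ x y, x ≠ y → 0 ≤ P x y) (hlazy : ∀ x, 1 / 2 ≤ P x x) (f : Ω → ℝ) :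
    0 ≤ ∑ x, ∑ y, μ x * P x y * f x * f y := by
  set K : Ω → Ω → ℝ := fun x y => μ x * (2 * P x y - if x = y then 1 else 0) with hK
  have h0 : 0 ≤ ∑ x, ∑ y, K x y * (f x + 1 * f y) ^ 2 := by
    refine Finset.sum_nonneg fun x _ => Finset.sum_nonneg fun y _ =>
      mul_nonneg (mul_nonneg (hμ x).le ?_) (sq_nonneg _)
    split_ifs with h
    · subst h; linarith [hlazy x]
    · linarith [hoff x y h]
  rw [dirichlet_expand K μ ?_ ?_ 1 (by norm_num)] at h0
  · have e : ∑ x, ∑ y, K x y * f x * f y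
        = 2 * ∑ x, ∑ y, μ x * P x y * f x * f y - ∑ x, μ x * f x ^ 2 := by
      rw [Finset.mul_sum, ← Finset.sum_sub_distrib]
      refine Finset.sum_congr rfl fun x _ => ?_
      have : μ x * f x ^ 2 = ∑ y, if x = y then μ x * f x * f y else 0 := by
        rw [Finset.sum_ite_eq]; simp; ring
      rw [this, Finset.mul_sum, ← Finset.sum_sub_distrib]
      refine Finset.sum_congr rfl fun y _ => ?_
      simp only [hK]; split_ifs <;> ring
    rw [e] at h0; linarith
  · intro x y
    simp only [hK]
    by_cases h : x = y
    · subst h; rfl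
    · rw [if_neg h, if_neg (Ne.symm h)]; linarith [hrev x y]
  · intro x
    simp only [hK]
    rw [← Finset.mul_sum, Finset.sum_sub_distrib, ← Finset.mul_sum, hrow, Finset.sum_ite_eq]
    simp; ring

lemma contraction (P : Matrix Ω Ω ℝ) (μ : Ω → ℝ)
    (hrev : ∀ x y, μ x * P x y = μ y * P y x) (hrow : ∀ x, ∑ y, P x y = 1)
    (hpsd : ∀ f : Ω → ℝ, 0 ≤ ∑ x, ∑ y, μ x * P x y * f x * f y) {c : ℝ} (hc : 0 < c)
    (hgap : ∀ f : Ω → ℝ, ∑ x, μ x * f x = 0 →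
      ∑ x, ∑ y, μ x * P x y * f x * f y ≤ c * ∑ x, μ x * f x ^ 2)
    (f g : Ω → ℝ) (hg : ∀ x, g x = ∑ y, P x y * f y) (hf : ∑ x, μ x * f x = 0) :
    ∑ x, μ x * g x = 0 ∧ ∑ x, μ x * g x ^ 2 ≤ c ^ 2 * ∑ x, μ x * f x ^ 2 := by
  have hg0 : ∑ x, μ x * g x = 0 := by
    rw [← hf]
    simp only [hg, Finset.mul_sum]
    rw [Finset.sum_comm]
    refine Finset.sum_congr rfl fun y _ => ?_
    rw [← mul_one (μ y * f y), ← hrow y, Finset.mul_sum]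
    refine Finset.sum_congr rfl fun x _ => ?_
    linear_combination f y * hrev x y
  refine ⟨hg0, ?_⟩
  have h1 := hgap f hf
  have h2 := hgap g hg0
  have h3 := hpsd fun x => c * f x - g x
  have e1 : ∑ x, ∑ y, μ x * P x y * g x * f y = ∑ x, μ x * g x ^ 2 := by
    refine Finset.sum_congr rfl fun x _ => ?_
    rw [sq]; nth_rewrite 3 [hg x]
    rw [Finset.mul_sum, Finset.mul_sum]
    exact Finset.sum_congr rfl fun y _ => by ring
  have e2 : ∑ x, ∑ y, μ x * P x y * f x * g y = ∑ x, μ x * g x ^ 2 := by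
    rw [← e1, Finset.sum_comm]
    refine Finset.sum_congr rfl fun x _ => Finset.sum_congr rfl fun y _ => ?_
    rw [hrev]; ring
  have e3 : ∑ x, ∑ y, μ x * P x y * (c * f x - g x) * (c * f y - g y)
      = c ^ 2 * ∑ x, ∑ y, μ x * P x y * f x * f y - c * ∑ x, ∑ y, μ x * P x y * g x * f y
        - c * ∑ x, ∑ y, μ x * P x y * f x * g y + ∑ x, ∑ y, μ x * P x y * g x * g y := by
    simp only [Finset.mul_sum, ← Finset.sum_add_distrib, ← Finset.sum_sub_distrib]
    exact Finset.sum_congr rfl fun x _ => Finset.sum_congr rfl fun y _ => by ring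
  rw [e3, e1, e2] at h3
  have h4 : 0 ≤ c * (c ^ 2 * ∑ x, μ x * f x ^ 2 - ∑ x, μ x * g x ^ 2) := by
    nlinarith [mul_le_mul_of_nonneg_left h1 (sq_nonneg c)]
  have := nonneg_of_mul_nonneg_right h4 hc
  linarith

lemma tv_bound (P : Matrix Ω Ω ℝ) (μ : Ω → ℝ) (hμ : ∀ x, 0 < μ x) (hμ1 : ∑ x, μ x = 1)
    (hrev : ∀ x y, μ x * P x y = μ y * P y x) (hrow : ∀ x, ∑ y, P x y = 1)
    (hpsd : ∀ f : Ω → ℝ, 0 ≤ ∑ x, ∑ y, μ x * P x y * f x * f y) {c : ℝ} (hc : 0 < c)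
    (hgap : ∀ f : Ω → ℝ, ∑ x, μ x * f x = 0 →
      ∑ x, ∑ y, μ x * P x y * f x * f y ≤ c * ∑ x, μ x * f x ^ 2)
    (x0 : Ω) (t : ℕ) : (2 * tvDist P μ x0 t) ^ 2 ≤ (c ^ 2) ^ t / μ x0 := by
  set k : ℕ → Ω → ℝ := fun t y => (P ^ t) x0 y / μ y - 1 with hk
  have hstep : ∀ t y, k (t + 1) y = ∑ z, P y z * k t z := by
    intro t y
    simp only [hk, pow_succ, Matrix.mul_apply, mul_sub, mul_one, Finset.sum_sub_distrib, hrow,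
      Finset.sum_div]
    congr 1
    refine Finset.sum_congr rfl fun z _ => ?_
    have := hrev y z
    have h1 := (hμ y).ne'
    have h2 := (hμ z).ne'
    field_simp
    linear_combination (-(P ^ t) x0 z) * this
  have hmain : ∀ t, ∑ x, μ x * k t x = 0 ∧ ∑ x, μ x * k t x ^ 2 ≤ (c ^ 2) ^ t / μ x0 := by
    intro t
    induction t with
    | zero =>
      have e : ∀ x, μ x * k 0 x = (if x0 = x then 1 else 0) - μ x := by
        intro x
        simp only [hk, pow_zero, Matrix.one_apply]
        have := (hμ x).ne'
        field_simp
      refine ⟨?_, ?_⟩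
      · simp only [e, Finset.sum_sub_distrib, hμ1]; simp
      · have e' : ∀ x, μ x * k 0 x ^ 2 = (if x0 = x then 1 / μ x0 - 2 else 0) + μ x := by
          intro x
          have := (hμ x).ne'
          have h2 : μ x * k 0 x ^ 2 = (μ x * k 0 x) ^ 2 / μ x := by field_simp
          rw [h2, e]
          split_ifs with h
          · subst h; field_simp; ring
          · field_simp; ring
        simp only [e', Finset.sum_add_distrib, hμ1]; simp; linarith
    | succ t ih =>
      obtain ⟨a, b⟩ := contraction P μ hrev hrow hpsd hc hgap (k t) (k (t + 1)) (hstep t) ih.1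
      refine ⟨a, b.trans ?_⟩
      calc c ^ 2 * ∑ x, μ x * k t x ^ 2 ≤ c ^ 2 * ((c ^ 2) ^ t / μ x0) :=
            mul_le_mul_of_nonneg_left ih.2 (sq_nonneg c)
        _ = _ := by rw [pow_succ (c ^ 2)]; ring
  have e : 2 * tvDist P μ x0 t = ∑ y, μ y * |k t y| := by
    unfold tvDist
    rw [← mul_assoc]; norm_num
    refine Finset.sum_congr rfl fun y _ => ?_
    nth_rewrite 2 [← abs_of_pos (hμ y)]
    rw [← abs_mul]
    congr 1
    have := (hμ y).ne'
    simp only [hk]; field_simp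
  rw [e]
  refine le_trans ?_ (hmain t).2
  have := Finset.sum_sq_le_sum_mul_sum_of_sq_le_mul Finset.univ (r := fun y => μ y * |k t y|)
    (f := μ) (g := fun y => μ y * k t y ^ 2) (fun y _ => (hμ y).le)
    (fun y _ => mul_nonneg (hμ y).le (sq_nonneg _))
    (fun y _ => le_of_eq (by simp only [mul_pow, sq_abs]; ring))
  rwa [hμ1, one_mul] at this

lemma sum_subtype_zero {α : Type*} [Fintype α] (p : α → Prop) [Fintype {a // p a}] (G : α → ℝ)
    (h : ∀ a, ¬ p a → G a = 0) : ∑ a, G a = ∑ x : {a // p a}, G x.val := by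
  rw [← Finset.sum_filter_of_ne (p := p) (fun a _ ha => by by_contra hc; exact ha (h a hc))]
  exact Finset.sum_subtype _ (by simp) _

lemma exchange_card {α : Type*} [Fintype α] [DecidableEq α] (n : ℕ) (S : Finset α)
    (hS : S.card = n) (hα : Fintype.card α = 2 * n) :
    (Finset.univ.filter fun T : Finset α => T.card = n ∧ (symmDiff S T).card = 2).card ≤ n ^ 2 := by
  have : (Finset.univ.filter fun T : Finset α => T.card = n ∧ (symmDiff S T).card = 2)
      ⊆ (S ×ˢ Sᶜ).image fun q => insert q.2 (S.erase q.1) := by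
    intro T hT
    simp only [Finset.mem_filter, Finset.mem_univ, true_and] at hT
    have e3 : (symmDiff S T).card = (S \ T).card + (T \ S).card := by
      rw [symmDiff_def, Finset.sup_eq_union, Finset.card_union_of_disjoint]
      exact disjoint_sdiff_sdiff
    have c1 := Finset.card_sdiff_add_card_inter S T
    have c2 := Finset.card_sdiff_add_card_inter T S
    rw [Finset.inter_comm] at c2
    have d1 : (S \ T).card = 1 := by omega
    have d2 : (T \ S).card = 1 := by omega
    obtain ⟨s, hs⟩ := Finset.card_eq_one.1 d1
    obtain ⟨t, ht⟩ := Finset.card_eq_one.1 d2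
    have ms : ∀ x, (x ∈ S ∧ x ∉ T) ↔ x = s := fun x => by
      rw [← Finset.mem_sdiff, hs, Finset.mem_singleton]
    have mt : ∀ x, (x ∈ T ∧ x ∉ S) ↔ x = t := fun x => by
      rw [← Finset.mem_sdiff, ht, Finset.mem_singleton]
    refine Finset.mem_image.2 ⟨(s, t), ?_, ?_⟩
    · simp only [Finset.mem_product, Finset.mem_compl]
      exact ⟨((ms s).2 rfl).1, ((mt t).2 rfl).2⟩
    · ext x
      simp only [Finset.mem_insert, Finset.mem_erase]
      have := ms x
      have := mt x
      tauto
  refine (Finset.card_le_card this).trans (Finset.card_image_le.trans ?_)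
  rw [Finset.card_product, Finset.card_compl, hα, hS, sq]
  apply le_of_eq; congr 1; omega

end Mixing

/-- Theorem 2 of the paper: fast mixing of the lazy Metropolis exchange
chain for the symmetric homogenization of a strongly Rayleigh distribution. -/
theorem mixing_time_symmHom_exchange_chain
    (N : ℕ) (π : Finset (Fin N) → ℝ)
    (hπ_nonneg : ∀ S, 0 ≤ π S) (hπ_sum : ∑ S : Finset (Fin N), π S = 1)
    (hSR : StronglyRayleigh π)
    -- the lazy Metropolis exchange chain for `π_sh`, restricted to its support:
    -- with prob. 1/2 stay put, else pick `s ∈ T`, `t ∉ T` uniformly (N choices each)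
    -- and exchange with the Metropolis probability
    (P : Matrix (HomState N π) (HomState N π) ℝ)
    (hPoff : ∀ S T : HomState N π, S ≠ T →
      P S T = if (symmDiff S.val T.val).card = 2 then
        (1 / (2 * (N : ℝ) ^ 2)) * min 1 (symmHom N π T.val / symmHom N π S.val)
      else 0)
    (hPdiag : ∀ S : HomState N π, P S S = 1 - ∑ T ∈ Finset.univ.erase S, P S T)
    (Y0 : HomState N π) (ε : ℝ) (hε : ε ∈ Set.Ioo (0 : ℝ) 1) :
    (mixingTime P (fun T => symmHom N π T.val) Y0 ε : ℝ) ≤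
      2 * (N : ℝ) ^ 2 *
        (Real.log (N.choose (restrictDown N Y0.val).card : ℝ) +
          Real.log (π (restrictDown N Y0.val))⁻¹ + Real.log ε⁻¹) := by
  have hsum : ∑ T : HomState N π, symmHom N π T.val = 1 := by
    rw [← hπ_sum, ← symmHom_sum]
    symm
    refine sum_subtype_zero (fun T => T.card = N ∧ 0 < symmHom N π T) _ fun T hT => ?_
    by_contra hc
    have h0 := (symmHom_nonneg N π hπ_nonneg T).lt_of_ne' hc
    refine hT ⟨?_, h0⟩
    by_contra h
    exact hc (by rw [symmHom, if_neg h])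
  have hpos : ∀ T : HomState N π, 0 < symmHom N π T.val := fun T => T.2.2
  have hm0 : symmHom N π Y0.val
      = π (restrictDown N Y0.val) / (N.choose (restrictDown N Y0.val).card : ℝ) := by
    rw [symmHom, if_pos Y0.2.1]
  have hm1 : symmHom N π Y0.val ≤ 1 := by
    rw [← hsum]
    exact Finset.single_le_sum (f := fun T : HomState N π => symmHom N π T.val)
      (fun T _ => (hpos T).le) (Finset.mem_univ Y0)
  have hmp := hpos Y0
  have hch : (0 : ℝ) < (N.choose (restrictDown N Y0.val).card : ℝ) := by
    exact_mod_cast Nat.choose_pos (card_le_N _)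
  have hpi : 0 < π (restrictDown N Y0.val) := by
    have := mul_pos hmp hch
    rwa [hm0, div_mul_cancel₀ _ hch.ne'] at this
  have hlog : Real.log (N.choose (restrictDown N Y0.val).card : ℝ) +
      Real.log (π (restrictDown N Y0.val))⁻¹ + Real.log ε⁻¹
        = - Real.log (ε * symmHom N π Y0.val) := by
    rw [Real.log_mul hε.1.ne' hmp.ne', hm0, Real.log_div hpi.ne' hch.ne', Real.log_inv,
      Real.log_inv]
    ring
  rw [hlog]
  set m := symmHom N π Y0.val with hm
  have hrow : ∀ S : HomState N π, ∑ T, P S T = 1 := by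
    intro S
    rw [← Finset.add_sum_erase _ _ (Finset.mem_univ S), hPdiag S]; ring
  rcases Nat.eq_zero_or_pos N with hN | hN
  · have hsub : ∀ T : HomState N π, T = Y0 := by
      intro T
      apply Subtype.ext
      have h1 : T.val = ∅ := Finset.card_eq_zero.1 (by rw [T.2.1, hN])
      have h2 : Y0.val = ∅ := Finset.card_eq_zero.1 (by rw [Y0.2.1, hN])
      rw [h1, h2]
    have hu : (Finset.univ : Finset (HomState N π)) = {Y0} := by
      ext T; simp [hsub T]
    have hP : P = 1 := by
      ext S T
      rw [hsub S, hsub T, Matrix.one_apply_eq, ← hrow Y0, hu, Finset.sum_singleton]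
    have : mixingTime P (fun T => symmHom N π T.val) Y0 ε ≤ 0 := by
      refine Nat.sInf_le fun t _ => ?_
      rw [hu, Finset.sum_singleton] at hsum
      unfold tvDist
      rw [hu, Finset.sum_singleton, hP, one_pow, Matrix.one_apply_eq]
      simp only [hsum]
      simpa using hε.1.le
    rw [Nat.le_zero.1 this, hN]; simp
  have hNr : (1 : ℝ) ≤ N := by exact_mod_cast hN
  have hN2 : (1 : ℝ) ≤ (N : ℝ) ^ 2 := one_le_pow₀ hNr
  set lam : ℝ := 1 / (2 * (N : ℝ) ^ 2) with hlam
  have hlam0 : 0 < lam := by positivity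
  have hlam1 : lam ≤ 1 / 2 := by
    rw [hlam]; exact one_div_le_one_div_of_le (by norm_num) (by linarith)
  have hK : ∀ S T : HomState N π, S ≠ T → symmHom N π S.val * P S T =
      if (symmDiff S.val T.val).card = 2 then
        lam * min (symmHom N π S.val) (symmHom N π T.val) else 0 := by
    intro S T hST
    rw [hPoff S T hST]
    split_ifs
    · have h := hpos S
      rw [mul_left_comm, mul_min_of_nonneg _ _ h.le, mul_one, mul_div_cancel₀ _ h.ne']
    · simp
  have hrev : ∀ S T : HomState N π,
      symmHom N π S.val * P S T = symmHom N π T.val * P T S := by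
    intro S T
    by_cases h : S = T
    · rw [h]
    · rw [hK S T h, hK T S (Ne.symm h), symmDiff_comm, min_comm]
  have hoff : ∀ S T : HomState N π, S ≠ T → 0 ≤ P S T := by
    intro S T h
    rw [hPoff S T h]
    split_ifs
    · exact mul_nonneg hlam0.le (le_min zero_le_one (div_nonneg (hpos T).le (hpos S).le))
    · exact le_rfl
  have hlazy : ∀ S : HomState N π, 1 / 2 ≤ P S S := by
    intro S
    rw [hPdiag S]
    have h1 : ∑ T ∈ Finset.univ.erase S, P S T ≤
        ∑ T : HomState N π, if (symmDiff S.val T.val).card = 2 then lam else 0 := by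
      refine (Finset.sum_le_sum (g := fun T : HomState N π =>
        if (symmDiff S.val T.val).card = 2 then lam else 0) fun T hT => ?_).trans
        (Finset.sum_le_sum_of_subset_of_nonneg (Finset.subset_univ _) fun T _ _ => ?_)
      · rw [hPoff S T (Finset.ne_of_mem_erase hT).symm]
        split_ifs
        · exact mul_le_of_le_one_right hlam0.le (min_le_left _ _)
        · exact le_rfl
      · split_ifs
        · exact hlam0.le
        · exact le_rfl
    have h2 : (Finset.univ.filter fun T : HomState N π =>
        (symmDiff S.val T.val).card = 2).card ≤ N ^ 2 := by
      refine le_trans ?_ (exchange_card N S.val S.2.1 (by simp))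
      refine Finset.card_le_card_of_injOn (fun T => T.val) ?_
        (fun a _ b _ hab => Subtype.ext hab)
      intro T hT
      have hT2 := (Finset.mem_filter.1 hT).2
      exact Finset.mem_coe.2 (Finset.mem_filter.2 ⟨Finset.mem_univ _, T.2.1, hT2⟩)
    rw [← Finset.sum_filter, Finset.sum_const, nsmul_eq_mul] at h1
    have h3 : ((Finset.univ.filter fun T : HomState N π =>
        (symmDiff S.val T.val).card = 2).card : ℝ) ≤ (N : ℝ) ^ 2 := by exact_mod_cast h2
    have h4 : (N : ℝ) ^ 2 * lam = 1 / 2 := by rw [hlam]; field_simp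
    nlinarith [mul_le_mul_of_nonneg_right h3 hlam0.le]
  have hgap : ∀ f : HomState N π → ℝ, ∑ x, symmHom N π x.val * f x = 0 →
      ∑ x, ∑ y, symmHom N π x.val * P x y * f x * f y
        ≤ (1 - lam) * ∑ x, symmHom N π x.val * f x ^ 2 := by
    intro f hf
    have hz : ∀ T, ¬ (T.card = N ∧ 0 < symmHom N π T) → symmHom N π T = 0 := by
      intro T hT
      by_contra hc
      have h0 := (symmHom_nonneg N π hπ_nonneg T).lt_of_ne' hc
      refine hT ⟨?_, h0⟩
      by_contra h
      exact hc (by rw [symmHom, if_neg h])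
    set F : Finset (Fin (2 * N)) → ℝ := fun T =>
      if h : T.card = N ∧ 0 < symmHom N π T then f ⟨T, h⟩ else 0 with hF
    have hFv : ∀ x : HomState N π, F x.val = f x := by
      intro x; simp only [hF]; rw [dif_pos x.2]
    have hp := poincare (wSupp (symmHom N π)).card (symmHom N π) le_rfl
      (symmHom_nonneg N π hπ_nonneg) N (fun S hS => by
        by_contra h
        exact hS (by rw [symmHom, if_neg h]))
      (symmHom_ray N π hπ_nonneg hπ_sum hSR) F
    have w1 : wI (symmHom N π) F = 0 := by
      rw [wI, sum_subtype_zero _ _ fun T hT => by rw [hz T hT, zero_mul]]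
      refine Eq.trans ?_ hf
      exact Finset.sum_congr rfl fun x _ => by rw [hFv]
    have w2 : wI (symmHom N π) (fun S => F S ^ 2) = ∑ x : HomState N π,
        symmHom N π x.val * f x ^ 2 := by
      rw [wI, sum_subtype_zero _ _ fun T hT => by rw [hz T hT, zero_mul]]
      exact Finset.sum_congr rfl fun x _ => by rw [hFv]
    have w3 : lam * wD (symmHom N π) F = ∑ x : HomState N π, ∑ y : HomState N π,
        symmHom N π x.val * P x y * (f x + (-1) * f y) ^ 2 := by
      rw [wD, sum_subtype_zero (fun T => T.card = N ∧ 0 < symmHom N π T) _ fun T hT => ?_, Finset.mul_sum]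
      · refine Finset.sum_congr rfl fun x _ => ?_
        rw [sum_subtype_zero (fun T => T.card = N ∧ 0 < symmHom N π T) _ fun T hT => ?_, Finset.mul_sum]
        · refine Finset.sum_congr rfl fun y _ => ?_
          rw [hFv, hFv]
          by_cases hxy : x = y
          · subst hxy; simp
          · rw [hK x y hxy]
            split_ifs <;> ring
        · rw [hz T hT, min_eq_right (symmHom_nonneg N π hπ_nonneg _)]; simp
      · refine Finset.sum_eq_zero fun R _ => ?_
        rw [hz T hT, min_eq_left (symmHom_nonneg N π hπ_nonneg _)]; simp
    rw [dirichlet_expand (fun x y : HomState N π => symmHom N π x.val * P x y)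
      (fun x => symmHom N π x.val) hrev (fun x => by rw [← Finset.mul_sum, hrow, mul_one])
      (-1) (by norm_num) f] at w3
    rw [w1, w2] at hp
    have hp2 := mul_le_mul_of_nonneg_left hp hlam0.le
    have e0 : (0 : ℝ) ^ 2 / wM (symmHom N π) = 0 := by simp
    rw [e0] at hp2
    linarith
  have hpsd := psd_of_lazy P (fun T => symmHom N π T.val) hpos hrev hrow hoff hlazy
  have htv := tv_bound P (fun T => symmHom N π T.val) hpos hsum hrev hrow hpsd
    (by linarith : 0 < 1 - lam) hgap Y0
  have hεm : 0 < ε * m := mul_pos hε.1 hmp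
  have hL0 : 0 ≤ - Real.log (ε * m) := by
    rw [neg_nonneg]
    exact Real.log_nonpos hεm.le (mul_le_one₀ hε.2.le hmp.le hm1)
  set B : ℝ := 2 * (N : ℝ) ^ 2 * (- Real.log (ε * m)) with hB
  have hB0 : 0 ≤ B := mul_nonneg (by positivity) hL0
  have hlB : lam * B = - Real.log (ε * m) := by
    rw [hB, hlam]; field_simp
  have hmix : mixingTime P (fun T => symmHom N π T.val) Y0 ε ≤ ⌊B⌋₊ := by
    refine Nat.sInf_le fun t ht => ?_
    have ht1 : B - 1 ≤ t := by
      have h1 := Nat.lt_floor_add_one B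
      have h2 : ((⌊B⌋₊ : ℕ) : ℝ) ≤ t := by exact_mod_cast ht
      linarith
    have hc : ((1 - lam) ^ 2) ^ t ≤ 4 * (ε * m) ^ 2 := by
      have h1 : 1 - lam ≤ Real.exp (-lam) := by linarith [Real.add_one_le_exp (-lam)]
      calc ((1 - lam) ^ 2) ^ t ≤ (Real.exp (-lam) ^ 2) ^ t :=
            pow_le_pow_left₀ (sq_nonneg _) (pow_le_pow_left₀ (by linarith) h1 2) t
        _ = Real.exp (- (2 * lam * t)) := by
            rw [← Real.exp_nat_mul, ← Real.exp_nat_mul]; congr 1; push_cast; ring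
        _ ≤ Real.exp (1 + (Real.log (ε * m) + Real.log (ε * m))) := by
            apply Real.exp_le_exp.2
            nlinarith [mul_le_mul_of_nonneg_left ht1 hlam0.le]
        _ = Real.exp 1 * (ε * m) ^ 2 := by
            rw [Real.exp_add, Real.exp_add, Real.exp_log hεm]; ring
        _ ≤ 4 * (ε * m) ^ 2 := by
            have := Real.exp_one_lt_d9
            exact mul_le_mul_of_nonneg_right (by linarith) (sq_nonneg _)
    have h2 : (2 * tvDist P (fun T => symmHom N π T.val) Y0 t) ^ 2 ≤ (2 * ε) ^ 2 := by
      refine (htv t).trans ?_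
      rw [div_le_iff₀ hmp]
      refine hc.trans ?_
      have : 0 ≤ 4 * ε ^ 2 * m * (1 - m) :=
        mul_nonneg (by have := hε.1; positivity) (by linarith)
      change _ ≤ (2 * ε) ^ 2 * m
      nlinarith
    have h3 := abs_le_of_sq_le_sq h2 (by linarith [hε.1])
    linarith [le_abs_self (2 * tvDist P (fun T => symmHom N π T.val) Y0 t)]
  exact (Nat.cast_le.2 hmix).trans (Nat.floor_le hB0)
end

section
/- Let V = [N] be partitioned into k nonempty blocks P_1,…,P_k, and let C = {S ⊆ V : |S ∩ P_i| = 1 for all 1 ≤ i ≤ k} be the set of bases of the partition matroid. Let F : 2^V → ℝ, β ≥ 0, and let π_C(S) = exp(βF(S))/Z_C for S ∈ C, where Z_C = Σ_{S∈C} exp(βF(S)). Let ζ_F = max_{S,T∈C} |F(S) + F(T) − F(S∩T) − F(S∪T)|. Consider the lazy Gibbs exchange chain on C: from state S, with probability 1/2 do nothing; otherwise choose s ∈ S uniformly at random and then t uniformly at random from P(s)\{s}, where P(s) is the block containing s (doing nothing if P(s)\{s} is empty), and move to T = S∪{t}\{s} with probability π_C(T)/(π_C(S) + π_C(T)), staying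 at S otherwise. Then for every starting state X0 ∈ C and every ε ∈ (0,1), the mixing time satisfies τ_{X0}(ε) ≤ 4k²·(max_i |P_i|)·exp(2βζ_F)·(log π_C(X0)^{-1} + log ε^{-1}). -/
open Finset
open scoped Classical

theorem jensen_aux {Ω : Type*} [Fintype Ω] (q f : Ω → ℝ) (hq : ∀ y, 0 ≤ q y)
    (h1 : ∑ y, q y = 1) : (∑ y, q y * f y) ^ 2 ≤ ∑ y, q y * f y ^ 2 := by
  have h : 0 ≤ ∑ y, q y * (f y - ∑ z, q z * f z) ^ 2 :=
    Finset.sum_nonneg fun y _ => mul_nonneg (hq y) (sq_nonneg _)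
  obtain ⟨m, hm⟩ : ∃ m, m = ∑ z, q z * f z := ⟨_, rfl⟩
  rw [← hm] at h ⊢
  have e : ∑ y, q y * (f y - m) ^ 2 = ∑ y, q y * f y ^ 2 - 2 * m * ∑ y, q y * f y
      + m ^ 2 * ∑ y, q y := by
    rw [Finset.mul_sum, Finset.mul_sum, ← Finset.sum_sub_distrib, ← Finset.sum_add_distrib]
    exact Finset.sum_congr rfl fun y _ => by ring
  rw [e, h1, ← hm] at h
  nlinarith

theorem step_aux {Ω : Type*} [Fintype Ω] [DecidableEq Ω]
    (P : Matrix Ω Ω ℝ) (μ : Ω → ℝ) (hμ : ∀ x, 0 < μ x)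
    (hnn : ∀ x y, x ≠ y → 0 ≤ P x y) (hlazy : ∀ x, 1 / 2 ≤ P x x)
    (hrow : ∀ x, ∑ y, P x y = 1) (hrev : ∀ x y, μ x * P x y = μ y * P y x)
    (f : Ω → ℝ) :
    ∑ x, μ x * (∑ y, P x y * f y) ^ 2 ≤
      ∑ x, μ x * f x ^ 2 - (1 / 2) * ∑ x, ∑ y, μ x * P x y * (f x - f y) ^ 2 := by
  set g : Ω → ℝ := fun x => ∑ y, P x y * f y with hg
  have hcol : ∀ y, ∑ x, μ x * P x y = μ y := by
    intro y
    rw [Finset.sum_congr rfl fun x _ => hrev x y, ← Finset.mul_sum, hrow, mul_one]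
  -- contraction of 2P - 1
  have hc : ∀ x, (2 * g x - f x) ^ 2 ≤ 2 * ∑ y, P x y * f y ^ 2 - f x ^ 2 := by
    intro x
    have := jensen_aux (fun y => 2 * P x y - if y = x then 1 else 0) f
      (by
        intro y
        by_cases h : y = x
        · subst h; have := hlazy y; simp; linarith
        · have := hnn x y (Ne.symm h); simp [h]; exact this)
      (by simp [Finset.sum_sub_distrib, ← Finset.mul_sum, hrow]; norm_num)
    simp only [sub_mul, Finset.sum_sub_distrib, ite_mul, one_mul, zero_mul, mul_assoc,
      ← Finset.mul_sum, Finset.sum_ite_eq', Finset.mem_univ, if_true] at this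
    exact this
  have hcs : ∑ x, μ x * (2 * g x - f x) ^ 2 ≤ ∑ x, μ x * f x ^ 2 := by
    calc ∑ x, μ x * (2 * g x - f x) ^ 2
        ≤ ∑ x, μ x * (2 * ∑ y, P x y * f y ^ 2 - f x ^ 2) :=
          Finset.sum_le_sum fun x _ => mul_le_mul_of_nonneg_left (hc x) (hμ x).le
      _ = 2 * (∑ x, ∑ y, μ x * P x y * f y ^ 2) - ∑ x, μ x * f x ^ 2 := by
          rw [Finset.mul_sum, ← Finset.sum_sub_distrib]
          refine Finset.sum_congr rfl fun x _ => ?_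
          simp only [mul_assoc, ← Finset.mul_sum]; ring
      _ = _ := by
          rw [Finset.sum_comm]
          simp only [← Finset.sum_mul, hcol]; ring
  have hcs2 : ∑ x, μ x * (2 * g x - f x) ^ 2 =
      4 * ∑ x, μ x * g x ^ 2 - 4 * ∑ x, μ x * f x * g x + ∑ x, μ x * f x ^ 2 := by
    rw [Finset.mul_sum, Finset.mul_sum, ← Finset.sum_sub_distrib, ← Finset.sum_add_distrib]
    exact Finset.sum_congr rfl fun y _ => by ring
  have hE : ∑ x, ∑ y, μ x * P x y * (f x - f y) ^ 2 =
      2 * ∑ x, μ x * f x ^ 2 - 2 * ∑ x, μ x * f x * g x := by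
    have e1 : ∀ x y, μ x * P x y * (f x - f y) ^ 2 =
      (μ x * f x ^ 2) * P x y - 2 * (μ x * f x * (P x y * f y)) + μ x * P x y * f y ^ 2 := by
      intros; ring
    simp only [e1, Finset.sum_add_distrib, Finset.sum_sub_distrib, ← Finset.mul_sum, hrow]
    rw [Finset.sum_comm (f := fun x y => μ x * P x y * f y ^ 2)]
    simp only [← Finset.sum_mul, hcol, hg]; ring
  rw [hE]; linarith

theorem mix_general {Ω : Type*} [Fintype Ω] [DecidableEq Ω]
    (P : Matrix Ω Ω ℝ) (μ : Ω → ℝ) (hμ : ∀ x, 0 < μ x) (hμ1 : ∑ x, μ x = 1)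
    (hnn : ∀ x y, x ≠ y → 0 ≤ P x y) (hlazy : ∀ x, 1 / 2 ≤ P x x)
    (hrow : ∀ x, ∑ y, P x y = 1) (hrev : ∀ x y, μ x * P x y = μ y * P y x)
    (g : ℝ) (hg0 : 0 < g) (hg : g ≤ 1 / 4)
    (hpoin : ∀ f : Ω → ℝ, 2 * g * (∑ x, μ x * f x ^ 2 - (∑ x, μ x * f x) ^ 2) ≤
      (1 / 2) * ∑ x, ∑ y, μ x * P x y * (f x - f y) ^ 2)
    (x0 : Ω) (ε : ℝ) (hε : 0 < ε) (t : ℕ)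
    (ht : Real.log (μ x0)⁻¹ + Real.log ε⁻¹ ≤ g * (t + 1)) : tvDist P μ x0 t ≤ ε := by
  set h : ℕ → Ω → ℝ := fun t y => (P ^ t) x0 y / μ y with hh
  have hstep : ∀ t y, h (t + 1) y = ∑ z, P y z * h t z := by
    intro t y
    simp only [hh, pow_succ, Matrix.mul_apply, Finset.sum_div]
    refine Finset.sum_congr rfl fun z _ => ?_
    have := hrev z y
    have h1 := (hμ z).ne'
    have h2 := (hμ y).ne'
    field_simp
    linear_combination (P ^ t) x0 z * this
  have hrowt : ∀ t, ∑ y, (P ^ t) x0 y = 1 := by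
    intro t
    induction t with
    | zero => simp [Matrix.one_apply]
    | succ t ih =>
      simp only [pow_succ, Matrix.mul_apply]
      rw [Finset.sum_comm]
      simp only [← Finset.mul_sum, hrow, mul_one, ih]
  have hmh : ∀ t y, μ y * h t y = (P ^ t) x0 y := by
    intro t y
    have h2 := (hμ y).ne'
    simp only [hh]; field_simp
  have hmean : ∀ t, ∑ y, μ y * h t y = 1 := by
    intro t; simp only [hmh, hrowt]
  have hle1 : μ x0 ≤ 1 := by
    rw [← hμ1]; exact Finset.single_le_sum (fun i _ => (hμ i).le) (Finset.mem_univ x0)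
  have hV : ∀ t, ∑ y, μ y * h t y ^ 2 - 1 ≤ (1 - 2 * g) ^ t * (μ x0)⁻¹ := by
    intro t
    induction t with
    | zero =>
      have : ∑ y, μ y * h 0 y ^ 2 = (μ x0)⁻¹ := by
        rw [Finset.sum_eq_single x0]
        · have h2 := (hμ x0).ne'
          simp [hh]; field_simp
        · intro b _ hb; simp [hh, Ne.symm hb]
        · simp
      rw [this]; simp
    | succ t ih =>
      have s := step_aux P μ hμ hnn hlazy hrow hrev (h t)
      have p := hpoin (h t)
      rw [hmean] at p
      simp only [← hstep] at s
      have : (1 - 2 * g) * (∑ y, μ y * h t y ^ 2 - 1) ≤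
          (1 - 2 * g) * ((1 - 2 * g) ^ t * (μ x0)⁻¹) :=
        mul_le_mul_of_nonneg_left ih (by linarith)
      rw [pow_succ]
      linarith
  have hsq : (∑ y, |(P ^ t) x0 y - μ y|) ^ 2 ≤ ∑ y, μ y * h t y ^ 2 - 1 := by
    have j := jensen_aux μ (fun y => |h t y - 1|) (fun y => (hμ y).le) hμ1
    have e1 : ∀ y, μ y * |h t y - 1| = |(P ^ t) x0 y - μ y| := by
      intro y
      rw [← hmh, ← abs_of_pos (hμ y), ← abs_mul, abs_of_pos (hμ y)]; congr 1; ring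
    simp only [e1, sq_abs] at j
    have e2 : ∑ y, μ y * (h t y - 1) ^ 2 = ∑ y, μ y * h t y ^ 2 - 2 * ∑ y, μ y * h t y
      + ∑ y, μ y := by
      rw [Finset.mul_sum, ← Finset.sum_sub_distrib, ← Finset.sum_add_distrib]
      exact Finset.sum_congr rfl fun y _ => by ring
    rw [e2, hmean, hμ1] at j
    linarith
  have hfin : (1 - 2 * g) ^ t * (μ x0)⁻¹ ≤ (2 * ε) ^ 2 := by
    have a1 : (1 - 2 * g) ^ t ≤ Real.exp (-(2 * g * t)) := by
      have : 1 - 2 * g ≤ Real.exp (-(2 * g)) := by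
        have := Real.add_one_le_exp (-(2 * g)); linarith
      calc (1 - 2 * g) ^ t ≤ Real.exp (-(2 * g)) ^ t := pow_le_pow_left₀ (by linarith) this t
        _ = _ := by rw [← Real.exp_nat_mul]; congr 1; ring
    have hL : 0 ≤ Real.log (μ x0)⁻¹ := Real.log_nonneg ((one_le_inv₀ (hμ x0)).2 hle1)
    have a2 : (μ x0)⁻¹ = Real.exp (Real.log (μ x0)⁻¹) :=
      (Real.exp_log (inv_pos.2 (hμ x0))).symm
    have a3 : ε ^ 2 = Real.exp (-(2 * Real.log ε⁻¹)) := by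
      rw [Real.log_inv]
      have : -(2 * -Real.log ε) = ((2 : ℕ) : ℝ) * Real.log ε := by push_cast; ring
      rw [this, Real.exp_nat_mul, Real.exp_log hε]
    have a4 : (4 : ℝ) ≥ Real.exp (1 / 2) := by
      have := Real.exp_one_lt_d9
      have := Real.exp_le_exp.2 (show (1 / 2 : ℝ) ≤ 1 by norm_num)
      linarith
    calc (1 - 2 * g) ^ t * (μ x0)⁻¹ ≤ Real.exp (-(2 * g * t)) * (μ x0)⁻¹ :=
          mul_le_mul_of_nonneg_right a1 (inv_pos.2 (hμ x0)).le
      _ = Real.exp (-(2 * g * t) + Real.log (μ x0)⁻¹) := by rw [Real.exp_add, ← a2]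
      _ ≤ Real.exp (1 / 2 + -(2 * Real.log ε⁻¹)) := Real.exp_le_exp.2 (by nlinarith)
      _ = Real.exp (1 / 2) * ε ^ 2 := by rw [Real.exp_add, a3]
      _ ≤ 4 * ε ^ 2 := mul_le_mul_of_nonneg_right a4 (sq_nonneg _)
      _ = _ := by ring
  have := abs_le_of_sq_le_sq (hsq.trans ((hV t).trans hfin)) (by linarith)
  unfold tvDist
  linarith [(le_abs_self _).trans this]

/-- Hybrid of `A` and `B`: first `i` coordinates of `B`, the others of `A`. -/
def hyb {k : ℕ} {α : Fin k → Type*} (i : ℕ) (A B : ∀ j, α j) : ∀ j, α j :=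
  fun j => if j.val < i then B j else A j

theorem hyb_hyb {k : ℕ} {α : Fin k → Type*} (i : ℕ) (A B : ∀ j, α j) :
    hyb i (hyb i A B) (hyb i B A) = A := by
  funext j; unfold hyb; split_ifs <;> rfl

theorem hyb_succ {k : ℕ} {α : Fin k → Type*} (i : Fin k) (A B : ∀ j, α j) :
    hyb (i.val + 1) A B = Function.update (hyb i.val A B) i (hyb i.val B A i) := by
  funext j
  by_cases h : j = i
  · subst h; simp [hyb]
  · have : j.val ≠ i.val := fun h' => h (Fin.ext h')
    rw [Function.update_of_ne h]
    have h2 : j.val < i.val + 1 ↔ j.val < i.val := by omega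
    simp only [hyb, h2]

theorem poincare_aux {k : ℕ} (α : Fin k → Type*) [∀ i, Fintype (α i)]
    [Fintype (∀ i, α i)]
    (π : (∀ i, α i) → ℝ) (hπ : ∀ x, 0 < π x) (h1 : ∑ x, π x = 1) (K : ℝ) (hK0 : 0 ≤ K)
    (hK : ∀ (i : ℕ) A B, π A * π B ≤ K * (π (hyb i A B) * π (hyb i B A)))
    (f : (∀ i, α i) → ℝ) :
    2 * (∑ x, π x * f x ^ 2 - (∑ x, π x * f x) ^ 2) ≤
      k * K * ∑ i : Fin k, ∑ S, ∑ t : α i,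
        π S * π (Function.update S i t) / (π S + π (Function.update S i t)) *
          (f S - f (Function.update S i t)) ^ 2 := by
  have hvar : 2 * (∑ x, π x * f x ^ 2 - (∑ x, π x * f x) ^ 2) =
      ∑ A, ∑ B, π A * π B * (f A - f B) ^ 2 := by
    have e1 : ∀ A B, π A * π B * (f A - f B) ^ 2 =
        (π A * f A ^ 2) * π B - 2 * (π A * f A * (π B * f B)) + π A * (π B * f B ^ 2) := by
      intros; ring
    simp only [e1, Finset.sum_add_distrib, Finset.sum_sub_distrib, ← Finset.mul_sum, h1,
      ← Finset.sum_mul]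
    ring
  have hpath : ∀ A B, (f A - f B) ^ 2 ≤
      k * ∑ i : Fin k, (f (hyb i.val A B) - f (hyb (i.val + 1) A B)) ^ 2 := by
    intro A B
    have ht : ∑ i : Fin k, (f (hyb i.val A B) - f (hyb (i.val + 1) A B)) = f A - f B := by
      rw [Fin.sum_univ_eq_sum_range (fun i => f (hyb i A B) - f (hyb (i + 1) A B)) k,
        Finset.sum_range_sub']
      congr 2
      · funext j; simp [hyb]
    rw [← ht]
    have := sq_sum_le_card_mul_sum_sq (s := (Finset.univ : Finset (Fin k)))
      (f := fun i : Fin k => f (hyb i.val A B) - f (hyb (i.val + 1) A B))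
    simpa using this
  -- the bound for a fixed coordinate
  have hcoord : ∀ i : Fin k, ∑ A, ∑ B, π A * π B *
      (f (hyb i.val A B) - f (hyb (i.val + 1) A B)) ^ 2 ≤
      K * ∑ S, ∑ t : α i,
        π S * π (Function.update S i t) / (π S + π (Function.update S i t)) *
          (f S - f (Function.update S i t)) ^ 2 := by
    intro i
    set w : (∀ i, α i) → (∀ i, α i) → ℝ := fun S T => π S * π T / (π S + π T) with hw
    have hw0 : ∀ S T, 0 ≤ w S T := fun S T => by
      have := hπ S; have := hπ T; simp only [hw]; positivity
    have hpt : ∀ A B, π A * π B ≤ K * (w (hyb i.val A B) (hyb (i.val + 1) A B) *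
        (π (hyb i.val B A) + π (hyb (i.val + 1) B A))) := by
      intro A B
      have a := hK i.val A B
      have b := hK (i.val + 1) A B
      have pS := hπ (hyb i.val A B)
      have pT := hπ (hyb (i.val + 1) A B)
      simp only [hw]
      generalize π (hyb i.val A B) = S at *
      generalize π (hyb (i.val + 1) A B) = T at *
      generalize π (hyb i.val B A) = S' at *
      generalize π (hyb (i.val + 1) B A) = T' at *
      rw [div_mul_eq_mul_div, ← mul_div_assoc, le_div_iff₀ (by linarith)]
      nlinarith [mul_le_mul_of_nonneg_left a pT.le, mul_le_mul_of_nonneg_left b pS.le]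
    have hsw : ∑ A, ∑ B, π A * π B * (f (hyb i.val A B) - f (hyb (i.val + 1) A B)) ^ 2 ≤
        ∑ A, ∑ B, K * (w (hyb i.val A B) (hyb (i.val + 1) A B) *
        (π (hyb i.val B A) + π (hyb (i.val + 1) B A))) *
        (f (hyb i.val A B) - f (hyb (i.val + 1) A B)) ^ 2 :=
      Finset.sum_le_sum fun A _ => Finset.sum_le_sum fun B _ =>
        mul_le_mul_of_nonneg_right (hpt A B) (sq_nonneg _)
    refine hsw.trans ?_
    -- change of variables
    let G : (∀ i, α i) → (∀ i, α i) → ℝ := fun S S' =>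
      K * (w S (Function.update S i (S' i)) * (π S' + π (Function.update S' i (S i)))) *
        (f S - f (Function.update S i (S' i))) ^ 2
    have hG : ∑ A, ∑ B, K * (w (hyb i.val A B) (hyb (i.val + 1) A B) *
        (π (hyb i.val B A) + π (hyb (i.val + 1) B A))) *
        (f (hyb i.val A B) - f (hyb (i.val + 1) A B)) ^ 2 = ∑ S, ∑ S', G S S' := by
      let φ : ((∀ i, α i) × (∀ i, α i)) → ((∀ i, α i) × (∀ i, α i)) :=
        fun p => (hyb i.val p.1 p.2, hyb i.val p.2 p.1)
      have hφ : Function.Involutive φ := fun p => by simp [φ, hyb_hyb]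
      rw [← Fintype.sum_prod_type', ← Fintype.sum_prod_type',
        ← Equiv.sum_comp hφ.toPerm (fun p => G p.1 p.2)]
      refine Finset.sum_congr rfl fun p _ => ?_
      simp only [Function.Involutive.coe_toPerm, φ, G, hyb_succ]
    rw [hG, Finset.mul_sum]
    refine Finset.sum_le_sum fun S _ => ?_
    have hfib : ∑ S', G S S' = ∑ t : α i, ∑ S' with S' i = t, G S S' :=
      (Finset.sum_fiberwise _ _ _).symm
    rw [hfib, Finset.mul_sum]
    refine Finset.sum_le_sum fun t _ => ?_
    have e : ∑ S' with S' i = t, G S S' = K * (w S (Function.update S i t) *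
        (f S - f (Function.update S i t)) ^ 2) *
        ∑ S' with S' i = t, (π S' + π (Function.update S' i (S i))) := by
      rw [Finset.mul_sum]
      refine Finset.sum_congr rfl fun S' hS' => ?_
      have : S' i = t := (Finset.mem_filter.1 hS').2
      simp only [G, this]; ring
    rw [e]
    by_cases hst : t = S i
    · subst hst; simp
    have hle : ∑ S' with S' i = t, (π S' + π (Function.update S' i (S i))) ≤ 1 := by
      rw [Finset.sum_add_distrib]
      have hinj : ∑ S' with S' i = t, π (Function.update S' i (S i)) =
          ∑ T ∈ (Finset.univ.filter fun S' : (∀ i, α i) => S' i = t).image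
            (fun S' => Function.update S' i (S i)), π T := by
        rw [Finset.sum_image]
        intro x hx y hy hxy
        have hx' : x i = t := by simpa using hx
        have hy' : y i = t := by simpa using hy
        funext j
        by_cases hj : j = i
        · subst hj; rw [hx', hy']
        · have := congrFun hxy j
          simpa [Function.update_of_ne hj] using this
      rw [hinj, ← Finset.sum_union, ← h1]
      · exact Finset.sum_le_sum_of_subset_of_nonneg (Finset.subset_univ _)
          fun x _ _ => (hπ x).le
      · rw [Finset.disjoint_left]
        intro x hx hx2
        obtain ⟨y, _, rfl⟩ := Finset.mem_image.1 hx2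
        have := (Finset.mem_filter.1 hx).2
        simp at this
        exact hst this.symm
    calc _ ≤ K * (w S (Function.update S i t) *
        (f S - f (Function.update S i t)) ^ 2) * 1 :=
          mul_le_mul_of_nonneg_left hle
            (mul_nonneg hK0 (mul_nonneg (hw0 _ _) (sq_nonneg _)))
      _ = _ := by rw [mul_one]
  rw [hvar]
  calc ∑ A, ∑ B, π A * π B * (f A - f B) ^ 2
      ≤ ∑ A, ∑ B, π A * π B *
        (k * ∑ i : Fin k, (f (hyb i.val A B) - f (hyb (i.val + 1) A B)) ^ 2) :=
        Finset.sum_le_sum fun A _ => Finset.sum_le_sum fun B _ =>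
          mul_le_mul_of_nonneg_left (hpath A B) (mul_pos (hπ A) (hπ B)).le
    _ = k * ∑ i : Fin k, ∑ A, ∑ B, π A * π B *
        (f (hyb i.val A B) - f (hyb (i.val + 1) A B)) ^ 2 := by
        have c1 : ∀ g : Fin k → (∀ i, α i) → (∀ i, α i) → ℝ,
            ∑ i, ∑ A, ∑ B, g i A B = ∑ A, ∑ B, ∑ i, g i A B := by
          intro g
          rw [Finset.sum_comm]
          exact Finset.sum_congr rfl fun A _ => Finset.sum_comm
        rw [c1, Finset.mul_sum]
        refine Finset.sum_congr rfl fun A _ => ?_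
        rw [Finset.mul_sum]
        refine Finset.sum_congr rfl fun B _ => ?_
        rw [← Finset.mul_sum]; ring
    _ ≤ k * ∑ i : Fin k, (K * ∑ S, ∑ t : α i,
        π S * π (Function.update S i t) / (π S + π (Function.update S i t)) *
          (f S - f (Function.update S i t)) ^ 2) :=
        mul_le_mul_of_nonneg_left (Finset.sum_le_sum fun i _ => hcoord i) (by positivity)
    _ = _ := by rw [← Finset.mul_sum, mul_assoc]

theorem sum_erase_upd {k : ℕ} (α : Fin k → Type*) [∀ i, Fintype (α i)]
    [Fintype (∀ i, α i)] [DecidableEq (∀ i, α i)] (S : ∀ i, α i) (g : (∀ i, α i) → ℝ)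
    (hg : ∀ T, T ≠ S → (∀ i t, T ≠ Function.update S i t) → g T = 0) :
    ∑ T ∈ Finset.univ.erase S, g T =
      ∑ i : Fin k, ∑ t ∈ Finset.univ.erase (S i), g (Function.update S i t) := by
  rw [Finset.sum_sigma']
  symm
  refine Finset.sum_of_injOn (fun p : (Σ i, α i) => Function.update S p.1 p.2) ?_ ?_ ?_ ?_
  · rintro ⟨i, t⟩ hp ⟨j, s⟩ hq h
    have ht : t ≠ S i := by simpa using hp
    have hs : s ≠ S j := by simpa using hq
    simp only at h
    have hij : i = j := by
      by_contra hij
      have := congrFun h i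
      rw [Function.update_self, Function.update_of_ne hij] at this
      exact ht this
    subst hij
    have := congrFun h i
    simp only [Function.update_self] at this
    rw [this]
  · rintro ⟨i, t⟩ hp
    have ht : t ≠ S i := by simpa using hp
    simp only [Finset.coe_erase, Finset.coe_univ, Set.mem_sdiff, Set.mem_univ, true_and,
      Set.mem_singleton_iff]
    intro h
    apply ht
    have := congrFun h i
    simpa using this
  · intro T hT hn
    have hT' : T ≠ S := (Finset.mem_erase.1 hT).1
    refine hg T hT' fun i t h => hn ⟨⟨i, t⟩, ?_, h.symm⟩
    have : t ≠ S i := by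
      rintro rfl
      exact hT' (by rw [h, Function.update_eq_self])
    simpa using this
  · intros; rfl

theorem chain_aux {k : ℕ} (hk : 0 < k) (α : Fin k → Type*) [∀ i, Fintype (α i)]
    [Fintype (∀ i, α i)] [DecidableEq (∀ i, α i)]
    (π : (∀ i, α i) → ℝ) (hπ : ∀ x, 0 < π x) (h1 : ∑ x, π x = 1) (K : ℝ) (hK0 : 1 ≤ K)
    (hK : ∀ (i : ℕ) A B, π A * π B ≤ K * (π (hyb i A B) * π (hyb i B A)))
    (M : ℝ) (hM1 : 1 ≤ M) (hM : ∀ i, (Fintype.card (α i) : ℝ) ≤ M)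
    (P : Matrix (∀ i, α i) (∀ i, α i) ℝ)
    (hswap : ∀ S i (t : α i), t ≠ S i → P S (Function.update S i t) =
      1 / (2 * (k : ℝ) * ((Fintype.card (α i) : ℝ) - 1)) *
        (π (Function.update S i t) / (π S + π (Function.update S i t))))
    (hzero : ∀ S T, T ≠ S → (∀ i t, T ≠ Function.update S i t) → P S T = 0)
    (hdiag : ∀ S, P S S = 1 - ∑ T ∈ Finset.univ.erase S, P S T)
    (x0 : ∀ i, α i) (ε : ℝ) (hε : 0 < ε) (t : ℕ)
    (ht : 4 * (k : ℝ) ^ 2 * M * K * (Real.log (π x0)⁻¹ + Real.log ε⁻¹) ≤ t + 1) :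
    tvDist P π x0 t ≤ ε := by
  have hk' : (1 : ℝ) ≤ k := by exact_mod_cast hk
  have hcard : ∀ (S : ∀ i, α i) i (t : α i), t ≠ S i → (1 : ℝ) ≤ (Fintype.card (α i) : ℝ) - 1 := by
    intro S i t h
    have : 1 < Fintype.card (α i) := Fintype.one_lt_card_iff.2 ⟨t, S i, h⟩
    have : (2 : ℝ) ≤ (Fintype.card (α i) : ℝ) := by exact_mod_cast this
    linarith
  have hswap0 : ∀ S i (t : α i), t ≠ S i → 0 ≤ P S (Function.update S i t) := by
    intro S i t h
    rw [hswap S i t h]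
    have a := hcard S i t h
    have b := hπ S
    have c := hπ (Function.update S i t)
    have : 0 ≤ (Fintype.card (α i) : ℝ) - 1 := by linarith
    positivity
  have hcases : ∀ S T, T ≠ S → (∃ i, ∃ t : α i, t ≠ S i ∧ T = Function.update S i t) ∨
      (∀ i t, T ≠ Function.update S i t) := by
    intro S T hST
    by_cases h : ∀ i t, T ≠ Function.update S i t
    · exact Or.inr h
    · push Not at h
      obtain ⟨i, t, h⟩ := h
      refine Or.inl ⟨i, t, ?_, h⟩
      rintro rfl
      exact hST (by rw [h, Function.update_eq_self])
  have hback : ∀ (S : ∀ i, α i) i (t : α i), S = Function.update (Function.update S i t) i (S i) := by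
    intro S i t; simp
  have hnn : ∀ x y, x ≠ y → 0 ≤ P x y := by
    intro S T h
    rcases hcases S T h.symm with ⟨i, t, h1, rfl⟩ | h2
    · exact hswap0 S i t h1
    · rw [hzero S T h.symm h2]
  have hrow : ∀ x, ∑ y, P x y = 1 := by
    intro x
    rw [← Finset.add_sum_erase _ _ (Finset.mem_univ x), hdiag]; ring
  have hlazy : ∀ x, 1 / 2 ≤ P x x := by
    intro S
    rw [hdiag, sum_erase_upd α S (fun T => P S T) (fun T => hzero S T)]
    have : ∀ i, ∑ t ∈ Finset.univ.erase (S i), P S (Function.update S i t) ≤ 1 / (2 * k) := by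
      intro i
      by_cases hc : Fintype.card (α i) = 1
      · have : Finset.univ.erase (S i) = ∅ := by
          rw [← Finset.card_eq_zero, Finset.card_erase_of_mem (Finset.mem_univ _),
            Finset.card_univ, hc]
        rw [this]; simp
      · have hpos : 0 < Fintype.card (α i) := Fintype.card_pos_iff.2 ⟨S i⟩
        have hc2 : (2 : ℝ) ≤ (Fintype.card (α i) : ℝ) := by
          have : 2 ≤ Fintype.card (α i) := by omega
          exact_mod_cast this
        calc _ ≤ ∑ t ∈ Finset.univ.erase (S i),
              1 / (2 * (k : ℝ) * ((Fintype.card (α i) : ℝ) - 1)) := by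
              refine Finset.sum_le_sum fun t ht => ?_
              have ht' : t ≠ S i := (Finset.mem_erase.1 ht).1
              rw [hswap S i t ht']
              have b := hπ S
              have c := hπ (Function.update S i t)
              have d : 0 ≤ (Fintype.card (α i) : ℝ) - 1 := by linarith
              refine mul_le_of_le_one_right (by positivity) ?_
              rw [div_le_one (by positivity)]
              linarith
          _ = 1 / (2 * k) := by
              rw [Finset.sum_const, Finset.card_erase_of_mem (Finset.mem_univ _),
                Finset.card_univ, nsmul_eq_mul, Nat.cast_sub hpos]
              have d : (Fintype.card (α i) : ℝ) - 1 ≠ 0 := by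
                intro h; linarith
              push_cast
              field_simp
    have h2 : ∑ i : Fin k, ∑ t ∈ Finset.univ.erase (S i), P S (Function.update S i t) ≤
        ∑ i : Fin k, (1 / (2 * k) : ℝ) := Finset.sum_le_sum fun i _ => this i
    have h3 : ∑ i : Fin k, (1 / (2 * k) : ℝ) = 1 / 2 := by
      rw [Finset.sum_const, Finset.card_univ, Fintype.card_fin, nsmul_eq_mul]
      field_simp
    linarith
  have hw : ∀ S i (t : α i), t ≠ S i → π S * P S (Function.update S i t) =
      1 / (2 * (k : ℝ) * ((Fintype.card (α i) : ℝ) - 1)) *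
        (π S * π (Function.update S i t) / (π S + π (Function.update S i t))) := by
    intro S i t h; rw [hswap S i t h]; ring
  have hrev : ∀ x y, π x * P x y = π y * P y x := by
    intro S T
    by_cases hST : T = S
    · subst hST; rfl
    rcases hcases S T hST with ⟨i, t, h1, rfl⟩ | h2
    · rw [hw S i t h1]
      have := hw (Function.update S i t) i (S i) (by simpa using h1.symm)
      rw [← hback] at this
      rw [this, add_comm, mul_comm (π S)]
    · rw [hzero S T hST h2, hzero T S (Ne.symm hST)]
      · ring
      · intro i t h
        apply h2 i (T i)
        rw [h]; simp
  have hK0' : 0 < K := by linarith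
  have hM0 : 0 < M := by linarith
  have hBig : 0 < 4 * (k : ℝ) ^ 2 * M * K := by positivity
  have hBig4 : 4 ≤ 4 * (k : ℝ) ^ 2 * M * K := by
    have a : 1 ≤ (k : ℝ) ^ 2 := one_le_pow₀ hk'
    have b : 1 ≤ (k : ℝ) ^ 2 * M := one_le_mul_of_one_le_of_one_le a hM1
    have c : 1 ≤ (k : ℝ) ^ 2 * M * K := one_le_mul_of_one_le_of_one_le b hK0
    linarith
  refine mix_general P π hπ h1 hnn hlazy hrow hrev (4 * (k : ℝ) ^ 2 * M * K)⁻¹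
    (inv_pos.2 hBig) ?_ ?_ x0 ε hε t ?_
  · rw [inv_le_comm₀ hBig (by norm_num)]; linarith
  · intro f
    have hp := poincare_aux α π hπ h1 K hK0'.le hK f
    have hE : ∑ i : Fin k, ∑ S, ∑ t : α i,
        π S * π (Function.update S i t) / (π S + π (Function.update S i t)) *
          (f S - f (Function.update S i t)) ^ 2 ≤
        (2 * k * M) * ∑ S, ∑ T, π S * P S T * (f S - f T) ^ 2 := by
      rw [Finset.sum_comm, Finset.mul_sum]
      refine Finset.sum_le_sum fun S _ => ?_
      have e1 : ∑ T, π S * P S T * (f S - f T) ^ 2 =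
          ∑ T ∈ Finset.univ.erase S, π S * P S T * (f S - f T) ^ 2 := by
        rw [Finset.sum_erase]; simp
      rw [e1, sum_erase_upd α S (fun T => π S * P S T * (f S - f T) ^ 2)
        (fun T a b => by rw [hzero S T a b]; ring), Finset.mul_sum]
      refine Finset.sum_le_sum fun i _ => ?_
      rw [← Finset.sum_erase (a := S i) _ (by simp), Finset.mul_sum]
      refine Finset.sum_le_sum fun t ht => ?_
      have ht' : t ≠ S i := (Finset.mem_erase.1 ht).1
      rw [hw S i t ht', ← mul_assoc, ← mul_assoc]
      refine mul_le_mul_of_nonneg_right ?_ (sq_nonneg _)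
      have b := hπ S
      have c := hπ (Function.update S i t)
      refine le_mul_of_one_le_left (by positivity) ?_
      have d := hcard S i t ht'
      rw [mul_one_div, le_div_iff₀ (by positivity)]
      have := hM i
      nlinarith
    have hp2 := hp.trans (mul_le_mul_of_nonneg_left hE (by positivity))
    rw [← mul_le_mul_iff_right₀ hBig]
    have : 4 * (k : ℝ) ^ 2 * M * K * (2 * (4 * (k : ℝ) ^ 2 * M * K)⁻¹ *
      (∑ x, π x * f x ^ 2 - (∑ x, π x * f x) ^ 2)) =
      2 * (∑ x, π x * f x ^ 2 - (∑ x, π x * f x) ^ 2) := by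
      field_simp
    rw [this]
    refine hp2.trans (le_of_eq ?_)
    ring
  · rw [inv_mul_eq_div, le_div_iff₀ hBig, mul_comm]; exact ht

theorem tvDist_equiv {Ω Ω' : Type*} [Fintype Ω] [DecidableEq Ω] [Fintype Ω'] [DecidableEq Ω']
    (e : Ω ≃ Ω') (P : Matrix Ω' Ω' ℝ) (μ : Ω' → ℝ) (x : Ω) (t : ℕ) :
    tvDist (P.submatrix e e) (fun y => μ (e y)) x t = tvDist P μ (e x) t := by
  have hp : (P.submatrix e e) ^ t = (P ^ t).submatrix e e := by
    induction t with
    | zero => simp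
    | succ t ih => rw [pow_succ, pow_succ, ih, Matrix.submatrix_mul_equiv]
  unfold tvDist
  rw [hp, ← Equiv.sum_comp e]
  rfl

/-- The basis associated with a choice of one element per block. -/
noncomputable def bs {N k : ℕ} (part : Fin N → Fin k) (x : ∀ i, {v // part v = i}) :
    Finset (Fin N) := Finset.univ.filter fun v => (x (part v)).1 = v

theorem mem_bs {N k : ℕ} (part : Fin N → Fin k) (x : ∀ i, {v // part v = i}) (v : Fin N) :
    v ∈ bs part x ↔ (x (part v)).1 = v := by simp [bs]

theorem mem_bs_self {N k : ℕ} (part : Fin N → Fin k) (x : ∀ i, {v // part v = i}) (i : Fin k)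
    (v : {v // part v = i}) : v.1 ∈ bs part x ↔ x i = v := by
  obtain ⟨v, rfl⟩ := v
  rw [mem_bs, Subtype.ext_iff]

theorem bs_card {N k : ℕ} (part : Fin N → Fin k) (x : ∀ i, {v // part v = i}) (i : Fin k) :
    ((bs part x).filter fun v => part v = i).card = 1 := by
  rw [Finset.card_eq_one]
  refine ⟨(x i).1, ?_⟩
  ext v
  rw [Finset.mem_filter, mem_bs, Finset.mem_singleton]
  constructor
  · rintro ⟨h, rfl⟩; exact h.symm
  · rintro rfl
    refine ⟨?_, (x i).2⟩
    rw [(x i).2]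

theorem bs_inj {N k : ℕ} (part : Fin N → Fin k) : Function.Injective (bs part) := by
  intro x y h
  funext i
  have : (x i).1 ∈ bs part y := by rw [← h, mem_bs_self]
  rw [mem_bs_self] at this
  exact this.symm

theorem bs_surj {N k : ℕ} (part : Fin N → Fin k) (S : Finset (Fin N))
    (hS : ∀ i : Fin k, (S.filter fun v => part v = i).card = 1) : ∃ x, bs part x = S := by
  have h : ∀ i, ∃ v, S.filter (fun v => part v = i) = {v} :=
    fun i => Finset.card_eq_one.1 (hS i)
  choose v hv using h
  have hm : ∀ i w, (w ∈ S ∧ part w = i) ↔ w = v i := by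
    intro i w
    have := Finset.ext_iff.1 (hv i) w
    simpa using this
  refine ⟨fun i => ⟨v i, ((hm i (v i)).2 rfl).2⟩, ?_⟩
  ext w
  rw [mem_bs]
  constructor
  · intro h; exact ((hm (part w) w).2 h.symm).1
  · intro h; exact ((hm (part w) w).1 ⟨h, rfl⟩).symm

theorem bs_update {N k : ℕ} (part : Fin N → Fin k) (x : ∀ i, {v // part v = i}) (i : Fin k)
    (t : {v // part v = i}) (ht : t ≠ x i) :
    bs part (Function.update x i t) = insert t.1 ((bs part x).erase (x i).1) := by
  ext v
  rw [Finset.mem_insert, Finset.mem_erase, mem_bs, mem_bs]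
  by_cases h : part v = i
  · subst h
    rw [Function.update_self]
    constructor
    · intro h; exact Or.inl h.symm
    · rintro (h | ⟨h1, h2⟩)
      · exact h.symm
      · exact absurd h2.symm h1
  · rw [Function.update_of_ne h]
    have a : v ≠ t.1 := fun h' => h (h' ▸ t.2)
    have b : v ≠ (x i).1 := fun h' => h (h' ▸ (x i).2)
    simp [a, b]

theorem bs_symmDiff {N k : ℕ} (part : Fin N → Fin k) (x y : ∀ i, {v // part v = i})
    (hxy : y ≠ x) (hn : ∀ i t, y ≠ Function.update x i t) :
    (symmDiff (bs part x) (bs part y)).card ≠ 2 := by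
  obtain ⟨i, hi⟩ := Function.ne_iff.1 hxy
  obtain ⟨j, hj⟩ := Function.ne_iff.1 (hn i (y i))
  have hij : j ≠ i := by
    rintro rfl; simp at hj
  rw [Function.update_of_ne hij] at hj
  have hsub : ({(x i).1, (y i).1, (x j).1} : Finset (Fin N)) ⊆
      symmDiff (bs part x) (bs part y) := by
    intro v hv
    simp only [Finset.mem_insert, Finset.mem_singleton] at hv
    rw [Finset.mem_symmDiff]
    rcases hv with rfl | rfl | rfl
    · left; rw [mem_bs_self, mem_bs_self]; exact ⟨rfl, hi⟩
    · right; rw [mem_bs_self, mem_bs_self]; exact ⟨rfl, hi.symm⟩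
    · left; rw [mem_bs_self, mem_bs_self]; exact ⟨rfl, hj⟩
  have hc : ({(x i).1, (y i).1, (x j).1} : Finset (Fin N)).card = 3 := by
    have p1 : (x i).1 ≠ (x j).1 := fun h => hij (by rw [← (x j).2, ← h, (x i).2])
    have p2 : (y i).1 ≠ (x j).1 := fun h => hij (by rw [← (x j).2, ← h, (y i).2])
    have p3 : (x i).1 ≠ (y i).1 := fun h => hi (Subtype.ext h.symm)
    rw [Finset.card_eq_three]
    exact ⟨_, _, _, p3, p1, p2, rfl⟩
  have := Finset.card_le_card hsub
  omega

theorem bs_hyb_union {N k : ℕ} (part : Fin N → Fin k) (i : ℕ) (A B : ∀ i, {v // part v = i}) :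
    bs part (hyb i A B) ∪ bs part (hyb i B A) = bs part A ∪ bs part B := by
  ext v
  simp only [Finset.mem_union, mem_bs, hyb]
  split_ifs <;> tauto

theorem bs_hyb_inter {N k : ℕ} (part : Fin N → Fin k) (i : ℕ) (A B : ∀ i, {v // part v = i}) :
    bs part (hyb i A B) ∩ bs part (hyb i B A) = bs part A ∩ bs part B := by
  ext v
  simp only [Finset.mem_inter, mem_bs, hyb]
  split_ifs <;> tauto

/-- mixing of the lazy Gibbs exchange chain on the bases of a
partition matroid.  The partition of `V = [N]` into `k` nonempty blocks is encoded by
a surjection `part : Fin N → Fin k`; a basis is a set meeting every block exactly once. -/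
theorem mixing_time_exchange_chain_partition_matroid_base
    (N k : ℕ) (hk : 0 < k)
    (part : Fin N → Fin k) (hsurj : Function.Surjective part)
    (F : Finset (Fin N) → ℝ) (β : ℝ) (hβ : 0 ≤ β)
    (ZC : ℝ)
    (hZC : ZC = ∑ S ∈ Finset.univ.filter
        (fun S : Finset (Fin N) => ∀ i : Fin k, (S.filter fun v => part v = i).card = 1),
      Real.exp (β * F S))
    (πC : Finset (Fin N) → ℝ)
    (hπC : ∀ S : Finset (Fin N), πC S = Real.exp (β * F S) / ZC)
    -- `ζ` is the maximum of `|F(S) + F(T) − F(S∩T) − F(S∪T)|` over `S, T ∈ C`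
    (ζ : ℝ)
    (hζ : IsGreatest {r : ℝ | ∃ S T : Finset (Fin N),
      (∀ i : Fin k, (S.filter fun v => part v = i).card = 1) ∧
      (∀ i : Fin k, (T.filter fun v => part v = i).card = 1) ∧
      r = |F S + F T - F (S ∩ T) - F (S ∪ T)|} ζ)
    -- the lazy Gibbs exchange chain on the bases: pick `s ∈ S` uniformly, then `t`
    -- uniformly in the block of `s` minus `s`, and swap with the Gibbs probability
    (P : Matrix {S : Finset (Fin N) // ∀ i : Fin k, (S.filter fun v => part v = i).card = 1}
      {S : Finset (Fin N) // ∀ i : Fin k, (S.filter fun v => part v = i).card = 1} ℝ)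
    (hPswap : ∀ (S T : {S : Finset (Fin N) //
        ∀ i : Fin k, (S.filter fun v => part v = i).card = 1}) (s t : Fin N),
      s ∈ S.val → t ∉ S.val → part t = part s → T.val = insert t (S.val.erase s) →
      P S T = (1 / (2 * (k : ℝ) *
          (((Finset.univ.filter fun v : Fin N => part v = part s).card : ℝ) - 1))) *
        (πC T.val / (πC S.val + πC T.val)))
    (hPzero : ∀ S T : {S : Finset (Fin N) //
        ∀ i : Fin k, (S.filter fun v => part v = i).card = 1}, S ≠ T →
      (symmDiff S.val T.val).card ≠ 2 → P S T = 0)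
    (hPdiag : ∀ S : {S : Finset (Fin N) //
        ∀ i : Fin k, (S.filter fun v => part v = i).card = 1},
      P S S = 1 - ∑ T ∈ Finset.univ.erase S, P S T)
    (X0 : {S : Finset (Fin N) // ∀ i : Fin k, (S.filter fun v => part v = i).card = 1})
    (ε : ℝ) (hε : ε ∈ Set.Ioo (0 : ℝ) 1) :
    (mixingTime P (fun S => πC S.val) X0 ε : ℝ) ≤
      4 * (k : ℝ) ^ 2 *
        ((Finset.univ.sup fun i : Fin k =>
          (Finset.univ.filter fun v : Fin N => part v = i).card : ℕ) : ℝ) *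
        Real.exp (2 * β * ζ) * (Real.log (πC X0.val)⁻¹ + Real.log ε⁻¹) := by
  let e : (∀ i, {v // part v = i}) ≃
      {S : Finset (Fin N) // ∀ i : Fin k, (S.filter fun v => part v = i).card = 1} :=
    Equiv.ofBijective (fun x => ⟨bs part x, bs_card part x⟩)
      ⟨fun x y h => bs_inj part (congrArg Subtype.val h), fun S => by
        obtain ⟨x, hx⟩ := bs_surj part S.1 S.2
        exact ⟨x, Subtype.ext hx⟩⟩
  have he : ∀ x, (e x).1 = bs part x := fun x => rfl
  obtain ⟨x0, rfl⟩ := e.surjective X0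
  have hsub : ∑ S : {S : Finset (Fin N) //
      ∀ i : Fin k, (S.filter fun v => part v = i).card = 1}, Real.exp (β * F S.1) = ZC := by
    rw [hZC]
    symm
    apply Finset.sum_subtype
    simp
  have hZsum : ∑ x, Real.exp (β * F (bs part x)) = ZC := by
    rw [← hsub, ← Equiv.sum_comp e]
    rfl
  have hZpos : 0 < ZC := by
    rw [← hZsum]
    exact Finset.sum_pos (fun _ _ => Real.exp_pos _) ⟨x0, Finset.mem_univ _⟩
  have hπpos : ∀ S, 0 < πC S := fun S => by rw [hπC]; positivity
  have hζb : ∀ A B, |F (bs part A) + F (bs part B) - F (bs part A ∩ bs part B)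
      - F (bs part A ∪ bs part B)| ≤ ζ :=
    fun A B => hζ.2 ⟨_, _, bs_card part A, bs_card part B, rfl⟩
  have hζ0 : 0 ≤ ζ := (abs_nonneg _).trans (hζb x0 x0)
  have hK : ∀ (i : ℕ) A B, πC (bs part A) * πC (bs part B) ≤
      Real.exp (2 * β * ζ) * (πC (bs part (hyb i A B)) * πC (bs part (hyb i B A))) := by
    intro i A B
    have a := (abs_le.1 (hζb A B)).2
    have b := (abs_le.1 (hζb (hyb i A B) (hyb i B A))).1
    rw [bs_hyb_union, bs_hyb_inter] at b
    simp only [hπC]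
    rw [div_mul_div_comm, div_mul_div_comm, ← mul_div_assoc, ← Real.exp_add, ← Real.exp_add,
      ← Real.exp_add]
    refine div_le_div_of_nonneg_right (Real.exp_le_exp.2 ?_) (by positivity)
    nlinarith
  set M : ℕ := Finset.univ.sup fun i : Fin k =>
          (Finset.univ.filter fun v : Fin N => part v = i).card with hM
  have hcardi : ∀ i : Fin k, Fintype.card {v // part v = i} =
      (Finset.univ.filter fun v : Fin N => part v = i).card :=
    fun i => Fintype.card_subtype _
  have hMi : ∀ i : Fin k, Fintype.card {v // part v = i} ≤ M := by
    intro i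
    rw [hcardi]
    exact Finset.le_sup (f := fun i : Fin k =>
          (Finset.univ.filter fun v : Fin N => part v = i).card) (Finset.mem_univ i)
  have hM1 : 1 ≤ M :=
    (Fintype.card_pos_iff.2 ⟨x0 ⟨0, hk⟩⟩ : 0 < Fintype.card {v // part v = ⟨0, hk⟩}).trans_le
      (hMi ⟨0, hk⟩)
  have key : ∀ t : ℕ, 4 * (k : ℝ) ^ 2 * (M : ℝ) * Real.exp (2 * β * ζ) *
      (Real.log (πC (e x0).val)⁻¹ + Real.log ε⁻¹) ≤ t + 1 →
      tvDist P (fun S => πC S.val) (e x0) t ≤ ε := by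
    intro t ht
    rw [← tvDist_equiv e P (fun S => πC S.val) x0 t]
    refine chain_aux hk (fun i => {v // part v = i}) (fun x => πC (bs part x))
      (fun x => hπpos _) ?_ (Real.exp (2 * β * ζ)) (Real.one_le_exp (by positivity)) hK
      (M : ℝ) (by exact_mod_cast hM1) (fun i => by exact_mod_cast hMi i) (P.submatrix e e)
      ?_ ?_ ?_ x0 ε hε.1 t ht
    · simp only [hπC, ← Finset.sum_div, hZsum]
      exact div_self hZpos.ne'
    · intro S i t hti
      have h1 : (S i).1 ∈ (e S).1 := by rw [he, mem_bs_self]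
      have h2 : t.1 ∉ (e S).1 := by rw [he, mem_bs_self]; exact fun h => hti h.symm
      have := hPswap (e S) (e (Function.update S i t)) (S i).1 t.1 h1 h2
        (by rw [t.2, (S i).2]) (bs_update part S i t hti)
      rw [Matrix.submatrix_apply, this, (S i).2, hcardi]
      rfl
    · intro S T hTS hn
      exact hPzero (e S) (e T) (fun h => hTS (e.injective h).symm) (bs_symmDiff part S T hTS hn)
    · intro S
      rw [Matrix.submatrix_apply, hPdiag]
      congr 1
      symm
      refine Finset.sum_equiv e ?_ ?_
      · intro T; simp
      · intros; rfl
  have hB0 : 0 ≤ 4 * (k : ℝ) ^ 2 * (M : ℝ) * Real.exp (2 * β * ζ) *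
      (Real.log (πC (e x0).val)⁻¹ + Real.log ε⁻¹) := by
    have l1 : 0 ≤ Real.log (πC (e x0).val)⁻¹ := by
      refine Real.log_nonneg ((one_le_inv₀ (hπpos _)).2 ?_)
      rw [hπC, div_le_one hZpos, ← hZsum]
      exact Finset.single_le_sum (f := fun x => Real.exp (β * F (bs part x)))
        (fun _ _ => (Real.exp_pos _).le) (Finset.mem_univ x0)
    have l2 : 0 ≤ Real.log ε⁻¹ := Real.log_nonneg ((one_le_inv₀ hε.1).2 hε.2.le)
    positivity
  refine le_trans ?_ (Nat.floor_le hB0)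
  refine Nat.cast_le.2 (Nat.sInf_le fun t ht => key t ?_)
  have h1 := Nat.lt_floor_add_one (4 * (k : ℝ) ^ 2 * (M : ℝ) * Real.exp (2 * β * ζ) *
      (Real.log (πC (e x0).val)⁻¹ + Real.log ε⁻¹))
  have h2 : ((⌊4 * (k : ℝ) ^ 2 * (M : ℝ) * Real.exp (2 * β * ζ) *
      (Real.log (πC (e x0).val)⁻¹ + Real.log ε⁻¹)⌋₊ : ℕ) : ℝ) ≤ t := Nat.cast_le.2 ht
  linarith
end
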